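/- arXiv:2507.12246 — 2 statements merged into one kernel-verified Lean document; each statement's English description precedes it below -/
import Mathlib

section
/- (Lower bound for the projected step via the truncated quadratic model) Assume c(x,y) ≥ 0 for all (x,y), let B, B̄ > 0 with λ(max{B,B̄}) := e^{2·max{B,B̄}} · E_{(x,y')∼μ⊗ν}[exp(c(x,y')/ε)] < ∞, and set S_B := { φ ∈ L²(ν) : ‖φ‖_{L^∞(𝒴)} ≤ B }. For η > 0 and φ ∈ S_{B̄}, let M(φ; η) be the minimizer over φ̄ ∈ S_B of ‖ φ̄ − (φ + η · δJ(φ)/ν) ‖²_{L²(ν)}, and for φ̄ ∈ S_B define the truncated quadratic model J̃_η(φ̄; φ) := J(φ) + ⟨ δJ(φ)/ν, φ̄ − φ ⟩_{L²(ν)} − ‖φ̄ − φ‖²_{L²(ν)}/(2η), where ⟨f,g⟩_{L²(ν)} := ∫_𝒴 f g dν. Then for every η ≤ λ(max{B,B̄})^{-1}, J(M(φ; η)) ≥ J̃_η(M(φ; η); φ). -/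
open MeasureTheory

noncomputable section

variable {d : ℕ}

/-- `φ⁺(x) = log ∫ exp(φ(y) - c(x,y)/ε) dν(y)`, with `ν` the density of the marginal on `𝒴`. -/
def phiPlus (ν : (Fin d → ℝ) → ℝ) (c : (Fin d → ℝ) → (Fin d → ℝ) → ℝ) (ε : ℝ)
    (φ : (Fin d → ℝ) → ℝ) (x : Fin d → ℝ) : ℝ :=
  Real.log (∫ y, Real.exp (φ y - c x y / ε) * ν y)

/-- The semi-dual `J(φ) = ∫ φ dν - ∫ φ⁺ dμ`. -/
def semiDual (μ ν : (Fin d → ℝ) → ℝ) (c : (Fin d → ℝ) → (Fin d → ℝ) → ℝ) (ε : ℝ)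
    (φ : (Fin d → ℝ) → ℝ) : ℝ :=
  (∫ y, φ y * ν y) - ∫ x, phiPlus ν c ε φ x * μ x

/-- The joint density `π(φ, φ⁺)(x,y) = exp(φ(y) - φ⁺(x) - c(x,y)/ε) μ(x) ν(y)`. -/
def piJoint (μ ν : (Fin d → ℝ) → ℝ) (c : (Fin d → ℝ) → (Fin d → ℝ) → ℝ) (ε : ℝ)
    (φ : (Fin d → ℝ) → ℝ) (z : (Fin d → ℝ) × (Fin d → ℝ)) : ℝ :=
  Real.exp (φ z.2 - phiPlus ν c ε φ z.1 - c z.1 z.2 / ε) * μ z.1 * ν z.2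

/-- The `𝒴`-marginal density of `π(φ, φ⁺)`. -/
def piY (μ ν : (Fin d → ℝ) → ℝ) (c : (Fin d → ℝ) → (Fin d → ℝ) → ℝ) (ε : ℝ)
    (φ : (Fin d → ℝ) → ℝ) (y : Fin d → ℝ) : ℝ :=
  ∫ x, piJoint μ ν c ε φ (x, y)

/-- First variation of the semi-dual: `δJ(φ) = ν - π(φ,φ⁺)_𝒴`. -/
def deltaJ (μ ν : (Fin d → ℝ) → ℝ) (c : (Fin d → ℝ) → (Fin d → ℝ) → ℝ) (ε : ℝ)
    (φ : (Fin d → ℝ) → ℝ) (y : Fin d → ℝ) : ℝ :=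
  ν y - piY μ ν c ε φ y

/-- `λ(B) = e^{2B} · E_{(x,y')∼μ⊗ν}[exp(c(x,y')/ε)]`. -/
def lamB (μ ν : (Fin d → ℝ) → ℝ) (c : (Fin d → ℝ) → (Fin d → ℝ) → ℝ) (ε B : ℝ) : ℝ :=
  Real.exp (2 * B) *
    ∫ z : (Fin d → ℝ) × (Fin d → ℝ), Real.exp (c z.1 z.2 / ε) * μ z.1 * ν z.2

section GibbsEstimates

open ProbabilityTheory

variable {α : Type*} [MeasurableSpace α] {Q : Measure α}

theorem inv_integral_exp_neg_le_integral_exp [IsProbabilityMeasure Q] {g : α → ℝ}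
    (hpos : Integrable (fun y ↦ Real.exp (g y)) Q)
    (hneg : Integrable (fun y ↦ Real.exp (-g y)) Q) :
    (∫ y, Real.exp (-g y) ∂Q)⁻¹ ≤ ∫ y, Real.exp (g y) ∂Q := by
  set Z := ∫ y, Real.exp (-g y) ∂Q with hZ
  have hZ0 : 0 < Z := integral_exp_pos hneg
  have h : ∫ y, (2 * Z⁻¹ - Z⁻¹ ^ 2 * Real.exp (-g y)) ∂Q ≤ ∫ y, Real.exp (g y) ∂Q := by
    refine integral_mono ((integrable_const _).sub (hneg.const_mul _)) hpos fun y ↦ ?_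
    have h1 : Real.exp (g y) * Real.exp (-g y) = 1 := by rw [← Real.exp_add]; simp
    have h2 : Real.exp (g y) * (1 - Z⁻¹ * Real.exp (-g y)) ^ 2 =
        Real.exp (g y) - (2 * Z⁻¹ - Z⁻¹ ^ 2 * Real.exp (-g y)) := by
      linear_combination (-2 * Z⁻¹ + Z⁻¹ ^ 2 * Real.exp (-g y)) * h1
    have h3 : 0 ≤ Real.exp (g y) * (1 - Z⁻¹ * Real.exp (-g y)) ^ 2 := by positivity
    simp only
    linarith
  rw [integral_sub (integrable_const _) (hneg.const_mul _), integral_const_mul (Z⁻¹ ^ 2), ← hZ] at h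
  simp only [integral_const, probReal_univ, one_smul] at h
  have : Z⁻¹ ^ 2 * Z = Z⁻¹ := by field_simp
  linarith

theorem integrable_exp_sub_of_bounded [IsFiniteMeasure Q] {f g : α → ℝ} {b : ℝ}
    (hf : Measurable f) (hg : Measurable g) (hg0 : ∀ y, 0 ≤ g y) (hfb : ∀ᵐ y ∂Q, |f y| ≤ b) :
    Integrable (fun y ↦ Real.exp (f y - g y)) Q := by
  refine .of_mem_Icc 0 (Real.exp b) (by fun_prop) ?_
  filter_upwards [hfb] with y hy
  refine ⟨by positivity, Real.exp_le_exp.2 ?_⟩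
  linarith [(abs_le.1 hy).2, hg0 y]

theorem inv_integral_exp_sub_le [IsProbabilityMeasure Q] {f g : α → ℝ} {b : ℝ}
    (hf : Measurable f) (hg : Measurable g) (hg0 : ∀ y, 0 ≤ g y) (hfb : ∀ᵐ y ∂Q, |f y| ≤ b)
    (hK : Integrable (fun y ↦ Real.exp (g y)) Q) :
    (∫ y, Real.exp (f y - g y) ∂Q)⁻¹ ≤ Real.exp b * ∫ y, Real.exp (g y) ∂Q := by
  have hneg : Integrable (fun y ↦ Real.exp (-g y)) Q := by
    simpa using integrable_exp_sub_of_bounded (Q := Q) (f := fun _ ↦ 0) (b := 0)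
      measurable_const hg hg0 (by simp)
  have hZ := inv_integral_exp_neg_le_integral_exp hK hneg
  have hZ0 : 0 < ∫ y, Real.exp (-g y) ∂Q := integral_exp_pos hneg
  have h : Real.exp (-b) * ∫ y, Real.exp (-g y) ∂Q ≤ ∫ y, Real.exp (f y - g y) ∂Q := by
    rw [← integral_const_mul]
    refine integral_mono_ae (hneg.const_mul _) (integrable_exp_sub_of_bounded hf hg hg0 hfb) ?_
    filter_upwards [hfb] with y hy
    rw [← Real.exp_add]
    exact Real.exp_le_exp.2 (by linarith [(abs_le.1 hy).1])
  calc (∫ y, Real.exp (f y - g y) ∂Q)⁻¹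
      ≤ (Real.exp (-b) * ∫ y, Real.exp (-g y) ∂Q)⁻¹ := by gcongr
    _ = Real.exp b * (∫ y, Real.exp (-g y) ∂Q)⁻¹ := by rw [mul_inv, Real.exp_neg, inv_inv]
    _ ≤ _ := by gcongr

theorem integral_sq_tilted_le [IsProbabilityMeasure Q] {f g h : α → ℝ} {b C : ℝ}
    (hf : Measurable f) (hg : Measurable g) (hg0 : ∀ y, 0 ≤ g y) (hfb : ∀ᵐ y ∂Q, |f y| ≤ b)
    (hh : Measurable h) (hhC : ∀ᵐ y ∂Q, |h y| ≤ C)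
    (hK : Integrable (fun y ↦ Real.exp (g y)) Q) :
    ∫ y, h y ^ 2 ∂(Q.tilted fun y ↦ f y - g y) ≤
      Real.exp (2 * b) * (∫ y, Real.exp (g y) ∂Q) * ∫ y, h y ^ 2 ∂Q := by
  have hsq : Integrable (fun y ↦ h y ^ 2) Q := by
    refine .of_mem_Icc 0 (C ^ 2) (by fun_prop) ?_
    filter_upwards [hhC] with y hy
    exact ⟨by positivity, sq_le_sq' (abs_le.1 hy).1 (abs_le.1 hy).2⟩
  rw [integral_tilted]
  calc ∫ y, (Real.exp (f y - g y) / ∫ y, Real.exp (f y - g y) ∂Q) • h y ^ 2 ∂Q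
      ≤ ∫ y, (Real.exp b * (Real.exp b * ∫ y, Real.exp (g y) ∂Q)) * h y ^ 2 ∂Q := by
        refine integral_mono_of_nonneg (ae_of_all _ fun y ↦ by
          have : 0 ≤ ∫ y, Real.exp (f y - g y) ∂Q := integral_nonneg fun y ↦ by positivity
          simp only [Pi.zero_apply, smul_eq_mul]; positivity) (hsq.const_mul _) ?_
        filter_upwards [hfb] with y hy
        rw [smul_eq_mul, div_eq_mul_inv]
        have h1 : Real.exp (f y - g y) ≤ Real.exp b :=
          Real.exp_le_exp.2 (by linarith [(abs_le.1 hy).2, hg0 y])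
        have h2 := inv_integral_exp_sub_le hf hg hg0 hfb hK
        have h3 : 0 ≤ (∫ y, Real.exp (f y - g y) ∂Q)⁻¹ :=
          inv_nonneg.2 (integral_nonneg fun y ↦ by positivity)
        gcongr
    _ = _ := by rw [integral_const_mul, two_mul, Real.exp_add]; ring

theorem tilted_add_const (f : α → ℝ) (a : ℝ) : Q.tilted (fun y ↦ f y + a) = Q.tilted f := by
  unfold Measure.tilted
  congr 1 with y
  simp_rw [Real.exp_add]
  rw [integral_mul_const, mul_div_mul_right _ _ (Real.exp_ne_zero a)]

/-- The log-partition function is smooth in `L²(Q)`, along bounded potentials. -/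
theorem log_integral_exp_sub_le [IsProbabilityMeasure Q] {φ ψ g : α → ℝ} {b : ℝ}
    (hφ : Measurable φ) (hψ : Measurable ψ) (hg : Measurable g) (hg0 : ∀ y, 0 ≤ g y)
    (hφb : ∀ᵐ y ∂Q, |φ y| ≤ b) (hψb : ∀ᵐ y ∂Q, |ψ y| ≤ b)
    (hK : Integrable (fun y ↦ Real.exp (g y)) Q) :
    Real.log (∫ y, Real.exp (ψ y - g y) ∂Q) ≤ Real.log (∫ y, Real.exp (φ y - g y) ∂Q) +
      ∫ y, (ψ y - φ y) ∂(Q.tilted fun y ↦ φ y - g y) +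
      Real.exp (2 * b) * (∫ y, Real.exp (g y) ∂Q) * (∫ y, (ψ y - φ y) ^ 2 ∂Q) / 2 := by
  have hφi := integrable_exp_sub_of_bounded hφ hg hg0 hφb
  have hψi := integrable_exp_sub_of_bounded hψ hg hg0 hψb
  set p := Q.tilted fun y ↦ φ y - g y with hp
  have : IsProbabilityMeasure p := isProbabilityMeasure_tilted hφi
  have hac : p ≪ Q := tilted_absolutelyContinuous _ _
  have hhb : ∀ᵐ y ∂Q, |ψ y - φ y| ≤ 2 * b := by
    filter_upwards [hφb, hψb] with y h1 h2
    rw [abs_le] at *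
    constructor <;> linarith
  set m := ∫ y, (ψ y - φ y) ∂p with hm
  set X : α → ℝ := fun y ↦ ψ y - φ y - m with hX
  have hXm : Measurable X := by fun_prop
  have hint : Integrable (fun y ↦ ψ y - φ y) p := by
    refine .of_mem_Icc (-(2 * b)) (2 * b) (by fun_prop) ?_
    filter_upwards [hac hhb] with y hy using abs_le.1 hy
  have hXb : ∀ᵐ y ∂p, X y ∈ Set.Icc (-(2 * b) - m) (2 * b - m) := by
    filter_upwards [hac hhb] with y hy
    rw [abs_le] at hy
    constructor <;> simp only [hX] <;> linarith
  have hXe (t : ℝ) : Integrable (fun y ↦ Real.exp (t * X y)) p :=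
    integrable_exp_mul_of_mem_Icc hXm.aemeasurable hXb
  have huniv : integrableExpSet X p = Set.univ := Set.eq_univ_of_forall hXe
  have hXc : ∫ y, X y ∂p = 0 := by
    simp only [hX]
    rw [integral_sub hint (integrable_const _)]
    simp [hm]
  obtain ⟨u, ⟨hu0, hu1⟩, hu⟩ := exists_cgf_eq_iteratedDeriv_two_cgf_mul (μ := p) (X := X)
    zero_lt_one hXc (by simp [huniv])
  have hcgf : cgf X p 1 = Real.log (∫ y, Real.exp (ψ y - g y) ∂Q) -
      Real.log (∫ y, Real.exp (φ y - g y) ∂Q) - m := by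
    have h1 : mgf X p 1 = (∫ y, Real.exp (ψ y - g y) ∂Q) /
        (∫ y, Real.exp (φ y - g y) ∂Q) * Real.exp (-m) := by
      simp only [mgf, one_mul]
      rw [hp, integral_exp_tilted, div_mul_eq_mul_div, ← integral_mul_const]
      congr 2 with y
      rw [← Real.exp_add]
      congr 1
      simp only [hX, Pi.add_apply]
      ring
    have hA := integral_exp_pos hψi
    have hB := integral_exp_pos hφi
    rw [cgf, h1, Real.log_mul (by positivity) (by positivity), Real.log_div hA.ne' hB.ne',
      Real.log_exp]
    ring
  have htilt : p.tilted (u * X ·) = Q.tilted fun y ↦ (φ y + u * (ψ y - φ y)) - g y := by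
    rw [hp, tilted_tilted hφi,
      ← tilted_add_const (fun y ↦ (φ y + u * (ψ y - φ y)) - g y) (-(u * m))]
    congr 1 with y
    simp only [hX, Pi.add_apply]
    ring
  have hfb : ∀ᵐ y ∂Q, |φ y + u * (ψ y - φ y)| ≤ b := by
    filter_upwards [hφb, hψb] with y h1 h2
    rw [abs_le] at *
    constructor <;> nlinarith
  have hvar : iteratedDeriv 2 (cgf X p) u ≤
      Real.exp (2 * b) * (∫ y, Real.exp (g y) ∂Q) * (∫ y, (ψ y - φ y) ^ 2 ∂Q) := by
    rw [← variance_tilted_mul (by simp [huniv])]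
    have hprob : IsProbabilityMeasure (p.tilted (u * X ·)) := isProbabilityMeasure_tilted (hXe u)
    have hmeas : Measurable fun y ↦ ψ y - φ y := by fun_prop
    simp only [hX]
    simp only [hX] at hprob htilt
    rw [variance_sub_const hmeas.aestronglyMeasurable]
    refine (variance_le_expectation_sq hmeas.aestronglyMeasurable).trans ?_
    rw [htilt]
    exact integral_sq_tilted_le (h := fun y ↦ ψ y - φ y) (by fun_prop) hg hg0 hfb hmeas hhb hK
  rw [hcgf] at hu
  linarith

theorem abs_log_integral_exp_sub_le [IsProbabilityMeasure Q] {f g : α → ℝ} {b : ℝ}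
    (hf : Measurable f) (hg : Measurable g) (hg0 : ∀ y, 0 ≤ g y) (hfb : ∀ᵐ y ∂Q, |f y| ≤ b)
    (hK : Integrable (fun y ↦ Real.exp (g y)) Q) :
    |Real.log (∫ y, Real.exp (f y - g y) ∂Q)| ≤ b + ∫ y, Real.exp (g y) ∂Q := by
  have hA := integral_exp_pos (integrable_exp_sub_of_bounded hf hg hg0 hfb)
  have hK0 := integral_exp_pos hK
  rw [abs_le]
  constructor
  · have h := Real.log_le_log (inv_pos.2 hA) (inv_integral_exp_sub_le hf hg hg0 hfb hK)
    rw [Real.log_inv, Real.log_mul (Real.exp_ne_zero b) hK0.ne', Real.log_exp] at h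
    linarith [Real.log_le_self hK0.le]
  · have h : ∫ y, Real.exp (f y - g y) ∂Q ≤ ∫ _, Real.exp b ∂Q := by
      refine integral_mono_ae (integrable_exp_sub_of_bounded hf hg hg0 hfb)
        (integrable_const _) ?_
      filter_upwards [hfb] with y hy
      exact Real.exp_le_exp.2 (by linarith [(abs_le.1 hy).2, hg0 y])
    have h' := Real.log_le_log hA h
    simp only [integral_const, probReal_univ, one_smul, Real.log_exp] at h'
    linarith

variable {β : Type*} [MeasurableSpace β] {P : Measure β}

theorem integrable_log_integral_exp_sub [IsProbabilityMeasure P] [IsProbabilityMeasure Q]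
    {f : α → ℝ} {g : β → α → ℝ} {b : ℝ} (hf : Measurable f)
    (hg : Measurable (Function.uncurry g)) (hg0 : ∀ x y, 0 ≤ g x y)
    (hfb : ∀ᵐ y ∂Q, |f y| ≤ b)
    (hK : Integrable (fun z : β × α ↦ Real.exp (g z.1 z.2)) (P.prod Q)) :
    Integrable (fun x ↦ Real.log (∫ y, Real.exp (f y - g x y) ∂Q)) P := by
  have hg' : Measurable fun z : β × α ↦ g z.1 z.2 := hg
  have hmeas : Measurable fun x ↦ ∫ y, Real.exp (f y - g x y) ∂Q := by
    have h : StronglyMeasurable fun z : β × α ↦ Real.exp (f z.2 - g z.1 z.2) := by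
      apply Measurable.stronglyMeasurable
      fun_prop
    exact h.integral_prod_right'.measurable
  refine ((integrable_const b).add hK.integral_prod_left).mono'
    (Real.measurable_log.comp hmeas).aestronglyMeasurable ?_
  filter_upwards [hK.prod_right_ae] with x hx
  exact abs_log_integral_exp_sub_le hf (hg.of_uncurry_left) (hg0 x) hfb hx

/-- Quadratic lower bound for the entropic semi-dual functional over bounded potentials. -/
theorem semiDual_quadratic_lower_bound [IsProbabilityMeasure P] [IsProbabilityMeasure Q]
    {φ ψ : α → ℝ} {g : β → α → ℝ} {b : ℝ} (hφ : Measurable φ) (hψ : Measurable ψ)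
    (hg : Measurable (Function.uncurry g)) (hg0 : ∀ x y, 0 ≤ g x y)
    (hφb : ∀ᵐ y ∂Q, |φ y| ≤ b) (hψb : ∀ᵐ y ∂Q, |ψ y| ≤ b)
    (hK : Integrable (fun z : β × α ↦ Real.exp (g z.1 z.2)) (P.prod Q)) :
    (∫ y, φ y ∂Q) - (∫ x, Real.log (∫ y, Real.exp (φ y - g x y) ∂Q) ∂P) +
      (∫ y, (1 - ∫ x, Real.exp (φ y - Real.log (∫ y, Real.exp (φ y - g x y) ∂Q) - g x y) ∂P) *
        (ψ y - φ y) ∂Q) -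
      Real.exp (2 * b) * (∫ z : β × α, Real.exp (g z.1 z.2) ∂(P.prod Q)) *
        (∫ y, (ψ y - φ y) ^ 2 ∂Q) / 2 ≤
    (∫ y, ψ y ∂Q) - ∫ x, Real.log (∫ y, Real.exp (ψ y - g x y) ∂Q) ∂P := by
  have hg' : Measurable fun z : β × α ↦ g z.1 z.2 := hg
  have hgx (x : β) : Measurable (g x) := hg.of_uncurry_left
  have hLφ := integrable_log_integral_exp_sub hφ hg hg0 hφb hK
  have hLψ := integrable_log_integral_exp_sub hψ hg hg0 hψb hK
  have hφx (x : β) := integrable_exp_sub_of_bounded hφ (hgx x) (hg0 x) hφb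
  have hφi : Integrable φ Q := .of_mem_Icc (-b) b hφ.aemeasurable (hφb.mono fun y ↦ abs_le.1)
  have hψi : Integrable ψ Q := .of_mem_Icc (-b) b hψ.aemeasurable (hψb.mono fun y ↦ abs_le.1)
  have hhb : ∀ᵐ y ∂Q, ‖ψ y - φ y‖ ≤ 2 * b := by
    filter_upwards [hφb, hψb] with y h1 h2
    rw [Real.norm_eq_abs]
    rw [abs_le] at *
    constructor <;> linarith
  set A : β → ℝ := fun x ↦ ∫ y, Real.exp (φ y - g x y) ∂Q with hA
  have hA0 (x : β) : 0 < A x := integral_exp_pos (hφx x)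
  have hAm : Measurable A := by
    have h : StronglyMeasurable fun z : β × α ↦ Real.exp (φ z.2 - g z.1 z.2) := by
      apply Measurable.stronglyMeasurable
      fun_prop
    exact h.integral_prod_right'.measurable
  set W : β → α → ℝ := fun x y ↦ Real.exp (φ y - Real.log (A x) - g x y) with hW
  have hWA (x : β) (y : α) : W x y = Real.exp (φ y - g x y) / A x := by
    simp only [hW]
    rw [sub_right_comm, Real.exp_sub, Real.exp_log (hA0 x)]
  have hWm : Measurable fun z : β × α ↦ W z.1 z.2 := by
    simp only [hW]
    fun_prop
  have hWi : Integrable (fun z : β × α ↦ W z.1 z.2) (P.prod Q) := by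
    rw [integrable_prod_iff hWm.aestronglyMeasurable]
    refine ⟨ae_of_all _ fun x ↦ ?_, ?_⟩
    · simp only [hWA]
      exact (hφx x).div_const _
    · have h (x : β) : ∫ y, ‖W x y‖ ∂Q = 1 := by
        have h' (y : α) : ‖W x y‖ = Real.exp (φ y - g x y) / A x :=
          (Real.norm_of_nonneg (Real.exp_nonneg _)).trans (hWA x y)
        simp only [h', integral_div]
        exact div_self (hA0 x).ne'
      simp only [h]
      exact integrable_const _
  have hWhi : Integrable (fun z : β × α ↦ W z.1 z.2 * (ψ z.2 - φ z.2)) (P.prod Q) := by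
    refine hWi.mul_bdd (c := 2 * b) (by fun_prop) ?_
    exact Measure.quasiMeasurePreserving_snd.ae hhb
  have hfubini : ∫ y, (∫ x, W x y ∂P) * (ψ y - φ y) ∂Q =
      ∫ x, ∫ y, (ψ y - φ y) ∂(Q.tilted fun y ↦ φ y - g x y) ∂P := by
    simp only [← integral_mul_const]
    rw [← integral_integral_swap (f := fun x y ↦ W x y * (ψ y - φ y)) hWhi]
    simp only [integral_tilted, hWA, smul_eq_mul, hA]
  have hTi : Integrable (fun x ↦ ∫ y, (ψ y - φ y) ∂(Q.tilted fun y ↦ φ y - g x y)) P := by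
    refine hWhi.integral_prod_left.congr (ae_of_all _ fun x ↦ ?_)
    simp only [integral_tilted, hWA, smul_eq_mul, hA]
  have hfirst : ∫ y, (1 - ∫ x, W x y ∂P) * (ψ y - φ y) ∂Q =
      (∫ y, ψ y ∂Q) - (∫ y, φ y ∂Q) -
        ∫ x, ∫ y, (ψ y - φ y) ∂(Q.tilted fun y ↦ φ y - g x y) ∂P := by
    have hdiff : Integrable (fun y ↦ ψ y - φ y) Q := hψi.sub hφi
    rw [← hfubini, ← integral_sub hψi hφi, ← integral_sub hdiff]
    · simp only [sub_mul, one_mul]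
    · simp only [← integral_mul_const]
      exact hWhi.integral_prod_right
  set S := ∫ y, (ψ y - φ y) ^ 2 ∂Q with hS
  have hKi : Integrable (fun x ↦ ∫ y, Real.exp (g x y) ∂Q) P := hK.integral_prod_left
  have hsum : Integrable (fun x ↦ Real.log (A x) +
      ∫ y, (ψ y - φ y) ∂(Q.tilted fun y ↦ φ y - g x y)) P := hLφ.add hTi
  have hlog : ∫ x, Real.log (∫ y, Real.exp (ψ y - g x y) ∂Q) ∂P ≤
      ∫ x, (Real.log (A x) + (∫ y, (ψ y - φ y) ∂(Q.tilted fun y ↦ φ y - g x y)) +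
        Real.exp (2 * b) * S / 2 * ∫ y, Real.exp (g x y) ∂Q) ∂P := by
    refine integral_mono_ae hLψ (hsum.add (hKi.const_mul _)) ?_
    filter_upwards [hK.prod_right_ae] with x hx
    have h := log_integral_exp_sub_le hφ hψ (hgx x) (hg0 x) hφb hψb hx
    simp only [hA, hS]
    linarith
  rw [integral_add hsum (hKi.const_mul _), integral_add hLφ hTi, integral_const_mul]
    at hlog
  rw [hfirst, integral_prod _ hK]
  linarith

end GibbsEstimates

section RealDensity

variable {α β : Type*} [MeasurableSpace α] [MeasurableSpace β] {κ : Measure α} {ρ : Measure β}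

theorem integral_withDensity_ofReal {w : α → ℝ} (hw : Measurable w) (hw0 : ∀ x, 0 ≤ w x)
    (f : α → ℝ) :
    ∫ x, f x ∂(κ.withDensity fun x ↦ ENNReal.ofReal (w x)) = ∫ x, f x * w x ∂κ := by
  rw [integral_withDensity_eq_integral_toReal_smul hw.ennreal_ofReal (by simp)]
  simp only [ENNReal.toReal_ofReal (hw0 _), smul_eq_mul, mul_comm]

theorem integrable_withDensity_ofReal_iff {w : α → ℝ} (hw : Measurable w) (hw0 : ∀ x, 0 ≤ w x)
    {f : α → ℝ} :
    Integrable f (κ.withDensity fun x ↦ ENNReal.ofReal (w x)) ↔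
      Integrable (fun x ↦ f x * w x) κ := by
  rw [integrable_withDensity_iff hw.ennreal_ofReal (by simp)]
  simp only [ENNReal.toReal_ofReal (hw0 _)]

theorem isProbabilityMeasure_withDensity_ofReal {w : α → ℝ} (hw0 : ∀ x, 0 ≤ w x)
    (hw1 : ∫ x, w x ∂κ = 1) :
    IsProbabilityMeasure (κ.withDensity fun x ↦ ENNReal.ofReal (w x)) := by
  refine ⟨?_⟩
  rw [withDensity_apply _ .univ, setLIntegral_univ, ← ofReal_integral_eq_lintegral_ofReal _ (ae_of_all _ hw0), hw1, ENNReal.ofReal_one]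
  exact .of_integral_ne_zero (by simp [hw1])

theorem prod_withDensity_ofReal [SFinite κ] [SFinite ρ] {v : α → ℝ} {w : β → ℝ}
    (hv : Measurable v) (hw : Measurable w) (hv0 : ∀ x, 0 ≤ v x) :
    (κ.withDensity fun x ↦ ENNReal.ofReal (v x)).prod
        (ρ.withDensity fun y ↦ ENNReal.ofReal (w y)) =
      (κ.prod ρ).withDensity fun z ↦ ENNReal.ofReal (v z.1 * w z.2) := by
  rw [prod_withDensity hv.ennreal_ofReal hw.ennreal_ofReal]
  simp only [ENNReal.ofReal_mul (hv0 _)]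

end RealDensity

/-- Lower bound for the projected step via the truncated quadratic model.
For `φ ∈ S_B̄` and `η ≤ λ(max{B,B̄})⁻¹`,
`J(M(φ;η)) ≥ J̃_η(M(φ;η); φ) = J(φ) + ⟨δJ(φ)/ν, M(φ;η) − φ⟩_{L²(ν)}
− ‖M(φ;η) − φ‖²_{L²(ν)}/(2η)`. -/
theorem projSGA_truncated_quadratic_lower_bound
    (μ ν : (Fin d → ℝ) → ℝ) (c : (Fin d → ℝ) → (Fin d → ℝ) → ℝ) (ε : ℝ)
    (hε : 0 < ε) (hμ0 : ∀ x, 0 ≤ μ x) (hν0 : ∀ y, 0 ≤ ν y)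
    (hμm : Measurable μ) (hνm : Measurable ν)
    (hμ1 : (∫ x, μ x) = 1) (hν1 : (∫ y, ν y) = 1)
    (hc : Measurable (Function.uncurry c))
    (hc0 : ∀ x y, 0 ≤ c x y)
    (B Bb : ℝ) (hB : 0 < B) (hBb : 0 < Bb)
    (hlamfin : Integrable
      (fun z : (Fin d → ℝ) × (Fin d → ℝ) => Real.exp (c z.1 z.2 / ε) * μ z.1 * ν z.2))
    (SB : Set ((Fin d → ℝ) → ℝ))
    (hSB : SB = {ψ | Measurable ψ ∧ ∀ᵐ y ∂(volume : Measure (Fin d → ℝ)), |ψ y| ≤ B})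
    (φ : (Fin d → ℝ) → ℝ) (hφm : Measurable φ)
    (hφBb : ∀ᵐ y ∂(volume : Measure (Fin d → ℝ)), |φ y| ≤ Bb)
    (M : ((Fin d → ℝ) → ℝ) → ℝ → ((Fin d → ℝ) → ℝ))
    (hM : ∀ η : ℝ, 0 < η → M φ η ∈ SB ∧ ∀ χ ∈ SB,
      (∫ y, (M φ η y - (φ y + η * (deltaJ μ ν c ε φ y / ν y))) ^ 2 * ν y) ≤
        ∫ y, (χ y - (φ y + η * (deltaJ μ ν c ε φ y / ν y))) ^ 2 * ν y)
    (η : ℝ) (hη : 0 < η) (hηle : η ≤ (lamB μ ν c ε (max B Bb))⁻¹) :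
    semiDual μ ν c ε (M φ η) ≥
      semiDual μ ν c ε φ +
        (∫ y, (deltaJ μ ν c ε φ y / ν y) * (M φ η y - φ y) * ν y) -
        (∫ y, (M φ η y - φ y) ^ 2 * ν y) / (2 * η) := by
  have hψ := (hM η hη).1
  rw [hSB] at hψ
  obtain ⟨hψm, hψB⟩ := hψ
  set ψ := M φ η
  set P : Measure (Fin d → ℝ) := volume.withDensity fun x ↦ ENNReal.ofReal (μ x)
  set Q : Measure (Fin d → ℝ) := volume.withDensity fun y ↦ ENNReal.ofReal (ν y)
  have hPprob : IsProbabilityMeasure P := isProbabilityMeasure_withDensity_ofReal hμ0 hμ1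
  have hQprob : IsProbabilityMeasure Q := isProbabilityMeasure_withDensity_ofReal hν0 hν1
  have hPint (f : (Fin d → ℝ) → ℝ) : ∫ x, f x ∂P = ∫ x, f x * μ x :=
    integral_withDensity_ofReal hμm hμ0 f
  have hQint (f : (Fin d → ℝ) → ℝ) : ∫ y, f y ∂Q = ∫ y, f y * ν y :=
    integral_withDensity_ofReal hνm hν0 f
  have hQac : Q ≪ volume := withDensity_absolutelyContinuous _ _
  have hPQ : P.prod Q = (volume : Measure ((Fin d → ℝ) × (Fin d → ℝ))).withDensity
      fun z ↦ ENNReal.ofReal (μ z.1 * ν z.2) := prod_withDensity_ofReal hμm hνm hμ0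
  have hw : Measurable fun z : (Fin d → ℝ) × (Fin d → ℝ) ↦ μ z.1 * ν z.2 := by fun_prop
  have hw0 (z : (Fin d → ℝ) × (Fin d → ℝ)) : 0 ≤ μ z.1 * ν z.2 := mul_nonneg (hμ0 _) (hν0 _)
  have hK : Integrable (fun z : (Fin d → ℝ) × (Fin d → ℝ) ↦ Real.exp (c z.1 z.2 / ε))
      (P.prod Q) := by
    rw [hPQ, integrable_withDensity_ofReal_iff hw hw0]
    simpa only [mul_assoc] using hlamfin
  have hlam : Real.exp (2 * max B Bb) *
      ∫ z : (Fin d → ℝ) × (Fin d → ℝ), Real.exp (c z.1 z.2 / ε) ∂(P.prod Q) =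
        lamB μ ν c ε (max B Bb) := by
    rw [hPQ, integral_withDensity_ofReal hw hw0, lamB]
    simp only [mul_assoc]
  have hplus (f : (Fin d → ℝ) → ℝ) (x : Fin d → ℝ) :
      Real.log (∫ y, Real.exp (f y - c x y / ε) ∂Q) = phiPlus ν c ε f x := by
    rw [hQint, phiPlus]
  have hdual (f : (Fin d → ℝ) → ℝ) :
      (∫ y, f y ∂Q) - ∫ x, phiPlus ν c ε f x ∂P = semiDual μ ν c ε f := by
    rw [hQint, hPint, semiDual]
  have hpiY (y : Fin d → ℝ) :
      piY μ ν c ε φ y = (∫ x, Real.exp (φ y - phiPlus ν c ε φ x - c x y / ε) ∂P) * ν y := by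
    rw [hPint, ← integral_mul_const]
    rfl
  have hmain := semiDual_quadratic_lower_bound (P := P) (Q := Q) (φ := φ) (ψ := ψ)
    (g := fun x y ↦ c x y / ε) (b := max B Bb) hφm hψm (hc.div_const ε)
    (fun x y ↦ div_nonneg (hc0 x y) hε.le)
    ((hφBb.filter_mono hQac.ae_le).mono fun y hy ↦ hy.trans (le_max_right _ _))
    ((hψB.filter_mono hQac.ae_le).mono fun y hy ↦ hy.trans (le_max_left _ _)) hK
  simp only [hplus, hdual, hlam] at hmain
  have hgrad : ∫ y, (1 - ∫ x, Real.exp (φ y - phiPlus ν c ε φ x - c x y / ε) ∂P) *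
      (ψ y - φ y) ∂Q = ∫ y, (deltaJ μ ν c ε φ y / ν y) * (ψ y - φ y) * ν y := by
    rw [hQint]
    congr 1 with y
    rw [deltaJ, hpiY]
    generalize (∫ x, Real.exp (φ y - phiPlus ν c ε φ x - c x y / ε) ∂P) = I
    rcases eq_or_ne (ν y) 0 with h | h
    · simp [h]
    · field_simp
  have hsq : lamB μ ν c ε (max B Bb) * (∫ y, (ψ y - φ y) ^ 2 ∂Q) / 2 ≤
      (∫ y, (ψ y - φ y) ^ 2 * ν y) / (2 * η) := by
    rw [← hQint, mul_comm 2 η, ← div_div, div_eq_inv_mul _ η]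
    have h0 : 0 ≤ ∫ y, (ψ y - φ y) ^ 2 ∂Q := integral_nonneg fun y ↦ sq_nonneg _
    have hle : lamB μ ν c ε (max B Bb) ≤ η⁻¹ :=
      (le_inv_comm₀ hη (inv_pos.1 (hη.trans_le hηle))).1 hηle
    gcongr
  rw [hgrad] at hmain
  linarith
end
end

section
/- (Key Lyapunov identity for the accelerated scheme) Assume c(x,y) ≥ 0 for all (x,y), let B > 0 with λ(3B) := e^{6B} · E_{(x,y')∼μ⊗ν}[exp(c(x,y')/ε)] < ∞, and set S_B := { φ ∈ L²(ν) : ‖φ‖_{L^∞(𝒴)} ≤ B }. For φ with ‖φ‖_{L^∞(𝒴)} ≤ 3B and η > 0 let M(φ; η) be the minimizer over φ̄ ∈ S_B of ‖ φ̄ − (φ + η · δJ(φ)/ν) ‖²_{L²(ν)}. Take φ¹ = φ̄⁰ ∈ S_B, t₁ = 1, and iterate φ̄^n := M(φ^n; λ(3B)^{-1}), t_{n+1} := (1 + √(1 + 4 t_n²))/2, φ^{n+1} := φ̄^n + ((t_n − 1)/t_{n+1})·(φ̄^n − φ̄^{n−1}). Let φ̃* be a maximizer of J over S_B, and define v_n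 := J(φ̃*) − J(φ̄^n) and u_n := t_n·φ̄^n − (t_n − 1)·φ̄^{n−1} − φ̃*. Then for every n ≥ 1, (2/λ(3B)) · ( t_n² v_n − t_{n+1}² v_{n+1} ) ≥ ‖u_{n+1}‖²_{L²(ν)} − ‖u_n‖²_{L²(ν)}. -/
open MeasureTheory

noncomputable section

variable {d : ℕ}

section LogIntegralExp

variable {Y : Type*} [MeasurableSpace Y] {Q : Measure Y} [IsProbabilityMeasure Q]

lemma integrable_of_ae_abs_le {f : Y → ℝ} {C : ℝ} (hf : Measurable f)
    (hC : ∀ᵐ y ∂Q, |f y| ≤ C) : Integrable f Q :=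
  Integrable.of_bound hf.aestronglyMeasurable C hC

lemma integrable_exp_sub {k φ : Y → ℝ} {R : ℝ} (hk : Measurable k) (hk0 : ∀ y, 0 ≤ k y)
    (hφ : Measurable φ) (hR : ∀ᵐ y ∂Q, |φ y| ≤ R) :
    Integrable (fun y => Real.exp (φ y - k y)) Q := by
  refine integrable_of_ae_abs_le (C := Real.exp R) (by fun_prop) ?_
  filter_upwards [hR] with y hy
  rw [abs_of_pos (Real.exp_pos _)]
  exact Real.exp_le_exp.2 (by linarith [hk0 y, (abs_le.1 hy).2])

lemma integrable_exp_neg {k : Y → ℝ} (hk : Measurable k) (hk0 : ∀ y, 0 ≤ k y) :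
    Integrable (fun y => Real.exp (-k y)) Q := by
  simpa using integrable_exp_sub (Q := Q) (φ := fun _ => 0) (R := 0) hk hk0 measurable_const
    (by simp)

lemma integral_exp_neg_pos {k : Y → ℝ} (hk : Measurable k) (hk0 : ∀ y, 0 ≤ k y) :
    0 < ∫ y, Real.exp (-k y) ∂Q :=
  integral_exp_pos (integrable_exp_neg hk hk0)

lemma exp_neg_mul_le_integral_exp_sub {k φ : Y → ℝ} {R : ℝ} (hk : Measurable k)
    (hk0 : ∀ y, 0 ≤ k y) (hφ : Measurable φ) (hR : ∀ᵐ y ∂Q, |φ y| ≤ R) :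
    Real.exp (-R) * ∫ y, Real.exp (-k y) ∂Q ≤ ∫ y, Real.exp (φ y - k y) ∂Q := by
  rw [← integral_const_mul]
  refine integral_mono_ae ((integrable_exp_neg hk hk0).const_mul _)
    (integrable_exp_sub hk hk0 hφ hR) ?_
  filter_upwards [hR] with y hy
  rw [← Real.exp_add]
  exact Real.exp_le_exp.2 (by linarith [(abs_le.1 hy).1])

lemma inv_integral_exp_neg_le {k : Y → ℝ} (hk : Measurable k) (hk0 : ∀ y, 0 ≤ k y)
    (hint : Integrable (fun y => Real.exp (k y)) Q) :
    (∫ y, Real.exp (-k y) ∂Q)⁻¹ ≤ ∫ y, Real.exp (k y) ∂Q := by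
  have hpos := integral_exp_neg_pos (Q := Q) hk hk0
  set a := ∫ y, Real.exp (-k y) ∂Q with ha
  have hle : ∫ y, (2 * a⁻¹ - a⁻¹ ^ 2 * Real.exp (-k y)) ∂Q ≤ ∫ y, Real.exp (k y) ∂Q := by
    refine integral_mono ((integrable_const _).sub ((integrable_exp_neg hk hk0).const_mul _))
      hint fun y => ?_
    have h1 : Real.exp (k y) * Real.exp (-k y) = 1 := by rw [← Real.exp_add]; simp
    have h2 := Real.exp_pos (k y)
    have h3 : Real.exp (-k y) = (Real.exp (k y))⁻¹ := Real.exp_neg _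
    have h4 : 0 ≤ (Real.exp (k y) - a⁻¹) ^ 2 * (Real.exp (k y))⁻¹ := by positivity
    have h5 : (Real.exp (k y) - a⁻¹) ^ 2 * (Real.exp (k y))⁻¹
        = Real.exp (k y) - 2 * a⁻¹ + a⁻¹ ^ 2 * (Real.exp (k y))⁻¹ := by
      field_simp; ring
    show 2 * a⁻¹ - a⁻¹ ^ 2 * Real.exp (-k y) ≤ Real.exp (k y)
    rw [h3]
    linarith
  rw [integral_sub (integrable_const _) ((integrable_exp_neg hk hk0).const_mul _),
    integral_const_mul (a⁻¹ ^ 2), ← ha] at hle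
  have h6 : a⁻¹ ^ 2 * a = a⁻¹ := by field_simp
  simp only [integral_const, probReal_univ, one_smul, h6] at hle
  linarith

lemma add_integral_mul_le_log_integral_exp {k φ ψ : Y → ℝ} {R : ℝ} (hk : Measurable k)
    (hk0 : ∀ y, 0 ≤ k y) (hφ : Measurable φ) (hR : ∀ᵐ y ∂Q, |φ y| ≤ R)
    (hψ : Measurable ψ) (hR' : ∀ᵐ y ∂Q, |ψ y| ≤ R) :
    Real.log (∫ y, Real.exp (φ y - k y) ∂Q) +
        ∫ y, (ψ y - φ y) * Real.exp (φ y - Real.log (∫ y, Real.exp (φ y - k y) ∂Q) - k y) ∂Q ≤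
      Real.log (∫ y, Real.exp (ψ y - k y) ∂Q) := by
  have hiφ := integrable_exp_sub (Q := Q) hk hk0 hφ hR
  have hiψ := integrable_exp_sub (Q := Q) hk hk0 hψ hR'
  have hZφ : 0 < ∫ y, Real.exp (φ y - k y) ∂Q := integral_exp_pos hiφ
  have hZψ : 0 < ∫ y, Real.exp (ψ y - k y) ∂Q := integral_exp_pos hiψ
  set Z := ∫ y, Real.exp (φ y - k y) ∂Q with hZ
  have hexp : ∀ y, Real.exp (φ y - Real.log Z - k y) = Z⁻¹ * Real.exp (φ y - k y) := by
    intro y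
    rw [show φ y - Real.log Z - k y = -Real.log Z + (φ y - k y) by ring, Real.exp_add,
      Real.exp_neg, Real.exp_log hZφ]
  simp_rw [hexp]
  have hbd : Integrable (fun y => (ψ y - φ y) * (Z⁻¹ * Real.exp (φ y - k y))) Q := by
    refine Integrable.bdd_mul (c := 2 * R) (hiφ.const_mul _)
      (hψ.sub hφ).aestronglyMeasurable ?_
    filter_upwards [hR, hR'] with y h1 h2
    rw [Real.norm_eq_abs]
    rw [abs_le] at *
    constructor <;> linarith
  set m := ∫ y, (ψ y - φ y) * (Z⁻¹ * Real.exp (φ y - k y)) ∂Q with hm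
  rw [Real.le_log_iff_exp_le hZψ, Real.exp_add, Real.exp_log hZφ]
  have hkey : ∫ y, Z * Real.exp m * ((ψ y - φ y) * (Z⁻¹ * Real.exp (φ y - k y))
        + (1 - m) * (Z⁻¹ * Real.exp (φ y - k y))) ∂Q ≤ ∫ y, Real.exp (ψ y - k y) ∂Q := by
    refine integral_mono ((hbd.add ((hiφ.const_mul _).const_mul _)).const_mul _) hiψ fun y => ?_
    have h1 := Real.add_one_le_exp (ψ y - φ y - m)
    have h2 : Real.exp (ψ y - k y)
        = Real.exp m * Real.exp (φ y - k y) * Real.exp (ψ y - φ y - m) := by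
      rw [← Real.exp_add, ← Real.exp_add]; ring_nf
    have h3 : 0 < Real.exp m * Real.exp (φ y - k y) := by positivity
    have h4 := mul_le_mul_of_nonneg_left h1 h3.le
    show Z * Real.exp m * ((ψ y - φ y) * (Z⁻¹ * Real.exp (φ y - k y))
        + (1 - m) * (Z⁻¹ * Real.exp (φ y - k y))) ≤ Real.exp (ψ y - k y)
    rw [h2]
    refine le_trans (le_of_eq ?_) h4
    field_simp
    ring
  rw [integral_const_mul, integral_add hbd ((hiφ.const_mul _).const_mul _), ← hm,
    integral_const_mul, integral_const_mul, ← hZ, inv_mul_cancel₀ hZφ.ne'] at hkey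
  linarith

open ProbabilityTheory in
lemma exists_cgf_one_eq {μ : Measure Y} [IsProbabilityMeasure μ] {h : Y → ℝ}
    (hs : integrableExpSet h μ = Set.univ) :
    ∃ u ∈ Set.Ioo (0 : ℝ) 1, cgf h μ 1 = ∫ y, h y ∂μ + iteratedDeriv 2 (cgf h μ) u / 2 := by
  have hu : UniqueDiffOn ℝ (Set.Icc (0 : ℝ) 1) := uniqueDiffOn_Icc zero_lt_one
  have hint : ∀ v : ℝ, v ∈ interior (integrableExpSet h μ) := by simp [hs]
  have hd : derivWithin (cgf h μ) (Set.Icc 0 1) 0 = ∫ y, h y ∂μ := by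
    rw [(analyticAt_cgf (hint 0)).differentiableAt.derivWithin (hu 0 (by simp)),
      deriv_cgf_zero (hint 0)]
    simp
  obtain ⟨u, hu1, hu2⟩ := taylor_mean_remainder_lagrange_iteratedDeriv (f := cgf h μ)
    (x₀ := 0) (x := 1) (n := 1) zero_ne_one (by
      rw [Set.uIcc_of_lt zero_lt_one]
      exact (analyticOn_cgf.mono (fun v _ => hint v)).contDiffOn hu)
  rw [Set.uIoo_of_lt zero_lt_one] at hu1
  refine ⟨u, hu1, ?_⟩
  rw [Set.uIcc_of_lt zero_lt_one] at hu2
  simp [hd] at hu2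
  linarith

open ProbabilityTheory in
lemma log_integral_exp_le_add_integral_mul {k φ ψ : Y → ℝ} {R : ℝ} (hk : Measurable k)
    (hk0 : ∀ y, 0 ≤ k y) (hφ : Measurable φ) (hR : ∀ᵐ y ∂Q, |φ y| ≤ R)
    (hψ : Measurable ψ) (hR' : ∀ᵐ y ∂Q, |ψ y| ≤ R) :
    Real.log (∫ y, Real.exp (ψ y - k y) ∂Q) ≤
      Real.log (∫ y, Real.exp (φ y - k y) ∂Q) +
        ∫ y, (ψ y - φ y) * Real.exp (φ y - Real.log (∫ y, Real.exp (φ y - k y) ∂Q) - k y) ∂Q +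
        Real.exp (2 * R) * (∫ y, Real.exp (-k y) ∂Q)⁻¹ / 2 * ∫ y, (ψ y - φ y) ^ 2 ∂Q := by
  have hiφ := integrable_exp_sub (Q := Q) hk hk0 hφ hR
  have hiψ := integrable_exp_sub (Q := Q) hk hk0 hψ hR'
  have hZφ : 0 < ∫ y, Real.exp (φ y - k y) ∂Q := integral_exp_pos hiφ
  have hZψ : 0 < ∫ y, Real.exp (ψ y - k y) ∂Q := integral_exp_pos hiψ
  have hkpos := integral_exp_neg_pos (Q := Q) hk hk0
  set Z := ∫ y, Real.exp (φ y - k y) ∂Q with hZ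
  have hexp : ∀ y, Real.exp (φ y - Real.log Z - k y) = Z⁻¹ * Real.exp (φ y - k y) := by
    intro y
    rw [show φ y - Real.log Z - k y = -Real.log Z + (φ y - k y) by ring, Real.exp_add,
      Real.exp_neg, Real.exp_log hZφ]
  simp_rw [hexp]
  set π := Q.tilted (fun y => φ y - k y) with hπ
  have : IsProbabilityMeasure π := isProbabilityMeasure_tilted hiφ
  set h : Y → ℝ := fun y => ψ y - φ y with hh
  have hmeas : Measurable h := hψ.sub hφ
  have hint : ∀ f : Y → ℝ, ∫ y, f y ∂π = Z⁻¹ * ∫ y, f y * Real.exp (φ y - k y) ∂Q := by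
    intro f
    rw [hπ, integral_tilted, ← integral_const_mul]
    refine integral_congr_ae (ae_of_all _ fun y => ?_)
    simp only [smul_eq_mul, ← hZ]
    ring
  have hbd : ∀ᵐ y ∂Q, |h y| ≤ 2 * R := by
    filter_upwards [hR, hR'] with y h1 h2
    rw [hh]
    rw [abs_le] at *
    constructor <;> linarith
  have hbdπ : ∀ᵐ y ∂π, |h y| ≤ 2 * R := (tilted_absolutelyContinuous Q _).ae_le hbd
  have hset : integrableExpSet h π = Set.univ := by
    refine Set.eq_univ_of_forall fun v => ?_
    refine integrable_of_ae_abs_le (C := Real.exp (|v| * (2 * R))) (by fun_prop) ?_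
    filter_upwards [hbdπ] with y hy
    rw [abs_of_pos (Real.exp_pos _)]
    refine Real.exp_le_exp.2 ((le_abs_self _).trans ?_)
    rw [abs_mul]
    exact mul_le_mul_of_nonneg_left hy (abs_nonneg _)
  obtain ⟨u, hu, heq⟩ := exists_cgf_one_eq hset
  rw [iteratedDeriv_two_cgf (by simp [hset])] at heq
  have hmgf : ∀ v, mgf h π v = Z⁻¹ * ∫ y, Real.exp (φ y + v * h y - k y) ∂Q := by
    intro v
    rw [mgf, hint]
    congr 1
    refine integral_congr_ae (ae_of_all _ fun y => ?_)
    simp only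
    rw [← Real.exp_add]
    ring_nf
  have hcgf : cgf h π 1 = Real.log (∫ y, Real.exp (ψ y - k y) ∂Q) - Real.log Z := by
    rw [cgf, hmgf, Real.log_mul (inv_ne_zero hZφ.ne') (by simpa [hh] using hZψ.ne'), Real.log_inv]
    simp [hh]
    ring
  have hRu : ∀ᵐ y ∂Q, |φ y + u * h y| ≤ R := by
    filter_upwards [hR, hR'] with y h1 h2
    simp only [hh]
    rw [abs_le] at *
    constructor <;> nlinarith [hu.1, hu.2]
  have hmeasu : Measurable fun y => φ y + u * h y := by fun_prop
  have hden := exp_neg_mul_le_integral_exp_sub (Q := Q) hk hk0 hmeasu hRu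
  have hnum : ∫ y, h y ^ 2 * Real.exp (u * h y) ∂π ≤
      Z⁻¹ * (Real.exp R * ∫ y, h y ^ 2 ∂Q) := by
    rw [hint]
    refine mul_le_mul_of_nonneg_left ?_ (inv_pos.2 hZφ).le
    rw [← integral_const_mul]
    have hsq : Integrable (fun y => h y ^ 2) Q := by
      refine integrable_of_ae_abs_le (C := (2 * R) ^ 2) (by fun_prop) ?_
      filter_upwards [hbd] with y hy
      rw [abs_pow]
      exact pow_le_pow_left₀ (abs_nonneg _) hy 2
    have hle : ∀ᵐ y ∂Q, h y ^ 2 * Real.exp (u * h y) * Real.exp (φ y - k y) ≤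
        Real.exp R * h y ^ 2 := by
      filter_upwards [hRu] with y hy
      rw [mul_assoc, ← Real.exp_add, mul_comm]
      refine mul_le_mul_of_nonneg_right (Real.exp_le_exp.2 ?_) (sq_nonneg _)
      linarith [hk0 y, (abs_le.1 hy).2]
    refine integral_mono_ae ?_ (hsq.const_mul _) hle
    refine (hsq.const_mul (Real.exp R)).mono' (by fun_prop) ?_
    filter_upwards [hle] with y hy
    rwa [Real.norm_eq_abs, abs_of_nonneg (by positivity)]
  have hA : 0 ≤ ∫ y, h y ^ 2 ∂Q := integral_nonneg fun y => sq_nonneg _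
  have hquot : (∫ y, h y ^ 2 * Real.exp (u * h y) ∂π) / mgf h π u ≤
      Real.exp (2 * R) * (∫ y, Real.exp (-k y) ∂Q)⁻¹ * ∫ y, h y ^ 2 ∂Q := by
    have hpos : 0 < mgf h π u := by
      rw [hmgf]
      exact mul_pos (inv_pos.2 hZφ) (lt_of_lt_of_le (by positivity) hden)
    rw [div_le_iff₀ hpos, hmgf]
    refine hnum.trans ?_
    have h1 := mul_le_mul_of_nonneg_left hden
      (show 0 ≤ Z⁻¹ * (Real.exp (2 * R) * (∫ y, Real.exp (-k y) ∂Q)⁻¹ * ∫ y, h y ^ 2 ∂Q) by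
        positivity)
    refine (le_of_eq ?_).trans (h1.trans (le_of_eq (by ring)))
    have h2 : Real.exp R = Real.exp (2 * R) * Real.exp (-R) := by rw [← Real.exp_add]; ring_nf
    rw [h2]
    field_simp
  have hmean : ∫ y, h y ∂π = ∫ y, h y * (Z⁻¹ * Real.exp (φ y - k y)) ∂Q := by
    rw [hint, ← integral_const_mul]
    refine integral_congr_ae (ae_of_all _ fun y => ?_)
    simp only
    ring
  rw [hcgf, hmean] at heq
  nlinarith [sq_nonneg (deriv (cgf h π) u)]

end LogIntegralExp

section EntropicDual

variable {X Y : Type*} [MeasurableSpace X] [MeasurableSpace Y]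

/-- The soft `c`-transform `x ↦ log ∫ exp(φ(y) - c(x,y)) dQ(y)`. -/
def softCTransform (Q : Measure Y) (c : X → Y → ℝ) (φ : Y → ℝ) (x : X) : ℝ :=
  Real.log (∫ y, Real.exp (φ y - c x y) ∂Q)

/-- The semi-dual functional of entropic transport between `P` and `Q`. -/
def entropicDual (P : Measure X) (Q : Measure Y) (c : X → Y → ℝ) (φ : Y → ℝ) : ℝ :=
  ∫ y, φ y ∂Q - ∫ x, softCTransform Q c φ x ∂P

/-- The density with respect to `Q` of the second marginal of the Gibbs coupling. -/
def gibbsDensity (P : Measure X) (Q : Measure Y) (c : X → Y → ℝ) (φ : Y → ℝ) (y : Y) : ℝ :=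
  ∫ x, Real.exp (φ y - softCTransform Q c φ x - c x y) ∂P

variable {P : Measure X} {Q : Measure Y} {c : X → Y → ℝ}

lemma gibbsDensity_nonneg (φ : Y → ℝ) (y : Y) : 0 ≤ gibbsDensity P Q c φ y :=
  integral_nonneg fun _ => (Real.exp_pos _).le

lemma ae_abs_sub_le {φ ψ : Y → ℝ} {R : ℝ} (hR : ∀ᵐ y ∂Q, |φ y| ≤ R)
    (hR' : ∀ᵐ y ∂Q, |ψ y| ≤ R) : ∀ᵐ y ∂Q, |ψ y - φ y| ≤ 2 * R := by
  filter_upwards [hR, hR'] with y h1 h2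
  rw [abs_le] at *
  constructor <;> linarith

variable [IsProbabilityMeasure Q]

lemma measurable_softCTransform (hc : Measurable (Function.uncurry c)) {φ : Y → ℝ}
    (hφ : Measurable φ) : Measurable (softCTransform Q c φ) := by
  have h : Measurable (Function.uncurry fun x y => Real.exp (φ y - c x y)) :=
    ((hφ.comp measurable_snd).sub hc).exp
  exact (h.stronglyMeasurable.integral_prod_right (ν := Q)).measurable.log

variable [IsProbabilityMeasure P]

lemma measurable_gibbsDensity (hc : Measurable (Function.uncurry c)) {φ : Y → ℝ}
    (hφ : Measurable φ) : Measurable (gibbsDensity P Q c φ) := by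
  have h : Measurable (Function.uncurry fun x y =>
      Real.exp (φ y - softCTransform Q c φ x - c x y)) :=
    (((hφ.comp measurable_snd).sub
      ((measurable_softCTransform (Q := Q) hc hφ).comp measurable_fst)).sub hc).exp
  exact (h.stronglyMeasurable.integral_prod_left (μ := P)).measurable

lemma ae_inv_integral_exp_neg_le (hc : Measurable (Function.uncurry c)) (hc0 : ∀ x y, 0 ≤ c x y)
    (hint : Integrable (fun z : X × Y => Real.exp (c z.1 z.2)) (P.prod Q)) :
    ∀ᵐ x ∂P, (∫ y, Real.exp (-c x y) ∂Q)⁻¹ ≤ ∫ y, Real.exp (c x y) ∂Q := by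
  filter_upwards [hint.prod_right_ae] with x hx
  exact inv_integral_exp_neg_le (hc.of_uncurry_left) (hc0 x) hx

lemma integrable_inv_integral_exp_neg (hc : Measurable (Function.uncurry c))
    (hc0 : ∀ x y, 0 ≤ c x y)
    (hint : Integrable (fun z : X × Y => Real.exp (c z.1 z.2)) (P.prod Q)) :
    Integrable (fun x => (∫ y, Real.exp (-c x y) ∂Q)⁻¹) P := by
  have h : Measurable (Function.uncurry fun x y => Real.exp (-c x y)) := hc.neg.exp
  refine hint.integral_prod_left.mono'
    (h.stronglyMeasurable.integral_prod_right (ν := Q)).measurable.inv.aestronglyMeasurable ?_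
  filter_upwards [ae_inv_integral_exp_neg_le hc hc0 hint] with x hx
  rwa [Real.norm_eq_abs,
    abs_of_pos (inv_pos.2 (integral_exp_neg_pos (hc.of_uncurry_left) (hc0 x)))]

lemma integral_inv_integral_exp_neg_le (hc : Measurable (Function.uncurry c))
    (hc0 : ∀ x y, 0 ≤ c x y)
    (hint : Integrable (fun z : X × Y => Real.exp (c z.1 z.2)) (P.prod Q)) :
    ∫ x, (∫ y, Real.exp (-c x y) ∂Q)⁻¹ ∂P ≤ ∫ z, Real.exp (c z.1 z.2) ∂(P.prod Q) := by
  rw [integral_prod _ hint]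
  exact integral_mono_ae (integrable_inv_integral_exp_neg hc hc0 hint) hint.integral_prod_left
    (ae_inv_integral_exp_neg_le hc hc0 hint)

lemma exp_neg_softCTransform_le (hc : Measurable (Function.uncurry c)) (hc0 : ∀ x y, 0 ≤ c x y)
    {φ : Y → ℝ} {R : ℝ} (hφ : Measurable φ) (hR : ∀ᵐ y ∂Q, |φ y| ≤ R) (x : X) :
    Real.exp (-softCTransform Q c φ x) ≤ Real.exp R * (∫ y, Real.exp (-c x y) ∂Q)⁻¹ := by
  have hcx : Measurable (c x) := hc.of_uncurry_left
  have hk := integral_exp_neg_pos (Q := Q) hcx (hc0 x)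
  have h := exp_neg_mul_le_integral_exp_sub (Q := Q) hcx (hc0 x) hφ hR
  rw [softCTransform, Real.exp_neg, Real.exp_log (lt_of_lt_of_le (by positivity) h)]
  refine (inv_anti₀ (by positivity) h).trans (le_of_eq ?_)
  rw [mul_inv, ← Real.exp_neg, neg_neg]

lemma softCTransform_le (hc : Measurable (Function.uncurry c)) (hc0 : ∀ x y, 0 ≤ c x y)
    {φ : Y → ℝ} {R : ℝ} (hφ : Measurable φ) (hR : ∀ᵐ y ∂Q, |φ y| ≤ R) (x : X) :
    softCTransform Q c φ x ≤ R := by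
  have hcx : Measurable (c x) := hc.of_uncurry_left
  have hi := integrable_exp_sub (Q := Q) hcx (hc0 x) hφ hR
  rw [softCTransform, Real.log_le_iff_le_exp (integral_exp_pos hi)]
  have : ∫ y, Real.exp (φ y - c x y) ∂Q ≤ ∫ _, Real.exp R ∂Q := by
    refine integral_mono_ae hi (integrable_const _) ?_
    filter_upwards [hR] with y hy
    exact Real.exp_le_exp.2 (by linarith [hc0 x y, (abs_le.1 hy).2])
  simpa using this

lemma integrable_softCTransform (hc : Measurable (Function.uncurry c)) (hc0 : ∀ x y, 0 ≤ c x y)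
    (hint : Integrable (fun z : X × Y => Real.exp (c z.1 z.2)) (P.prod Q))
    {φ : Y → ℝ} {R : ℝ} (hφ : Measurable φ) (hR : ∀ᵐ y ∂Q, |φ y| ≤ R) :
    Integrable (softCTransform Q c φ) P := by
  have hW := integrable_inv_integral_exp_neg hc hc0 hint
  refine ((hW.const_mul (Real.exp R)).add (integrable_const |R|)).mono'
    (measurable_softCTransform hc hφ).aestronglyMeasurable (ae_of_all _ fun x => ?_)
  have h1 := exp_neg_softCTransform_le hc hc0 hφ hR x
  have h2 := softCTransform_le hc hc0 hφ hR x
  have h3 := Real.add_one_le_exp (-softCTransform Q c φ x)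
  have h4 := Real.exp_pos (-softCTransform Q c φ x)
  rw [Real.norm_eq_abs, abs_le]
  show -(Real.exp R * (∫ y, Real.exp (-c x y) ∂Q)⁻¹ + |R|) ≤ _ ∧
    _ ≤ Real.exp R * (∫ y, Real.exp (-c x y) ∂Q)⁻¹ + |R|
  constructor <;> linarith [le_abs_self R, abs_nonneg R]

lemma exp_sub_softCTransform_sub_le (hc : Measurable (Function.uncurry c))
    (hc0 : ∀ x y, 0 ≤ c x y) {φ : Y → ℝ} {R : ℝ} (hφ : Measurable φ)
    (hR : ∀ᵐ y ∂Q, |φ y| ≤ R) {y : Y} (hy : |φ y| ≤ R) (x : X) :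
    Real.exp (φ y - softCTransform Q c φ x - c x y) ≤
      Real.exp (2 * R) * (∫ y, Real.exp (-c x y) ∂Q)⁻¹ := by
  have h1 := exp_neg_softCTransform_le hc hc0 hφ hR x
  calc Real.exp (φ y - softCTransform Q c φ x - c x y)
      ≤ Real.exp (R + -softCTransform Q c φ x) :=
        Real.exp_le_exp.2 (by linarith [hc0 x y, (abs_le.1 hy).2])
    _ = Real.exp R * Real.exp (-softCTransform Q c φ x) := Real.exp_add _ _
    _ ≤ Real.exp R * (Real.exp R * (∫ y, Real.exp (-c x y) ∂Q)⁻¹) :=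
        mul_le_mul_of_nonneg_left h1 (Real.exp_pos _).le
    _ = Real.exp (2 * R) * (∫ y, Real.exp (-c x y) ∂Q)⁻¹ := by
        rw [← mul_assoc, ← Real.exp_add, two_mul]

lemma ae_gibbsDensity_le (hc : Measurable (Function.uncurry c)) (hc0 : ∀ x y, 0 ≤ c x y)
    (hint : Integrable (fun z : X × Y => Real.exp (c z.1 z.2)) (P.prod Q))
    {φ : Y → ℝ} {R : ℝ} (hφ : Measurable φ) (hR : ∀ᵐ y ∂Q, |φ y| ≤ R) :
    ∀ᵐ y ∂Q, gibbsDensity P Q c φ y ≤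
      Real.exp (2 * R) * ∫ z, Real.exp (c z.1 z.2) ∂(P.prod Q) := by
  filter_upwards [hR] with y hy
  have hW := (integrable_inv_integral_exp_neg hc hc0 hint).const_mul (Real.exp (2 * R))
  have h := integral_mono_of_nonneg (μ := P)
    (ae_of_all _ fun x => (Real.exp_pos (φ y - softCTransform Q c φ x - c x y)).le) hW
    (ae_of_all _ fun x => exp_sub_softCTransform_sub_le hc hc0 hφ hR hy x)
  rw [integral_const_mul] at h
  exact h.trans (mul_le_mul_of_nonneg_left (integral_inv_integral_exp_neg_le hc hc0 hint)
    (Real.exp_pos _).le)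

lemma integrable_mul_gibbs (hc : Measurable (Function.uncurry c)) (hc0 : ∀ x y, 0 ≤ c x y)
    (hint : Integrable (fun z : X × Y => Real.exp (c z.1 z.2)) (P.prod Q))
    {φ h : Y → ℝ} {R C : ℝ} (hφ : Measurable φ) (hR : ∀ᵐ y ∂Q, |φ y| ≤ R)
    (hh : Measurable h) (hC : ∀ᵐ y ∂Q, |h y| ≤ C) :
    Integrable (Function.uncurry fun x y =>
      h y * Real.exp (φ y - softCTransform Q c φ x - c x y)) (P.prod Q) := by
  have hW := ((integrable_inv_integral_exp_neg hc hc0 hint).const_mul (Real.exp (2 * R))).const_mul C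
  have hm : Measurable (Function.uncurry fun x y =>
      h y * Real.exp (φ y - softCTransform Q c φ x - c x y)) :=
    (hh.comp measurable_snd).mul (((hφ.comp measurable_snd).sub
      ((measurable_softCTransform (Q := Q) hc hφ).comp measurable_fst)).sub hc).exp
  refine (hW.comp_fst Q).mono' hm.aestronglyMeasurable ?_
  filter_upwards [Measure.quasiMeasurePreserving_snd.ae hR,
    Measure.quasiMeasurePreserving_snd.ae hC] with z h1 h2
  rw [Function.uncurry, Real.norm_eq_abs, abs_mul, abs_of_pos (Real.exp_pos _)]
  exact mul_le_mul h2 (exp_sub_softCTransform_sub_le hc hc0 hφ hR h1 z.1) (Real.exp_pos _).le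
    ((abs_nonneg _).trans h2)

lemma integral_integral_mul_gibbs (hc : Measurable (Function.uncurry c))
    (hc0 : ∀ x y, 0 ≤ c x y)
    (hint : Integrable (fun z : X × Y => Real.exp (c z.1 z.2)) (P.prod Q))
    {φ h : Y → ℝ} {R C : ℝ} (hφ : Measurable φ) (hR : ∀ᵐ y ∂Q, |φ y| ≤ R)
    (hh : Measurable h) (hC : ∀ᵐ y ∂Q, |h y| ≤ C) :
    ∫ x, ∫ y, h y * Real.exp (φ y - softCTransform Q c φ x - c x y) ∂Q ∂P =
      ∫ y, h y * gibbsDensity P Q c φ y ∂Q := by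
  rw [integral_integral_swap (integrable_mul_gibbs hc hc0 hint hφ hR hh hC)]
  simp_rw [integral_const_mul]
  rfl

lemma memLp_top_gibbsDensity (hc : Measurable (Function.uncurry c)) (hc0 : ∀ x y, 0 ≤ c x y)
    (hint : Integrable (fun z : X × Y => Real.exp (c z.1 z.2)) (P.prod Q))
    {φ : Y → ℝ} {R : ℝ} (hφ : Measurable φ) (hR : ∀ᵐ y ∂Q, |φ y| ≤ R) :
    MemLp (gibbsDensity P Q c φ) ⊤ Q := by
  refine memLp_top_of_bound (measurable_gibbsDensity hc hφ).aestronglyMeasurable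
    (Real.exp (2 * R) * ∫ z, Real.exp (c z.1 z.2) ∂(P.prod Q)) ?_
  filter_upwards [ae_gibbsDensity_le hc hc0 hint hφ hR] with y hy
  rwa [Real.norm_eq_abs, abs_of_nonneg (gibbsDensity_nonneg φ y)]

lemma integral_sub_mul_one_sub_gibbsDensity (hc : Measurable (Function.uncurry c))
    (hc0 : ∀ x y, 0 ≤ c x y)
    (hint : Integrable (fun z : X × Y => Real.exp (c z.1 z.2)) (P.prod Q))
    {φ ψ : Y → ℝ} {R : ℝ} (hφ : Measurable φ) (hR : ∀ᵐ y ∂Q, |φ y| ≤ R)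
    (hψ : Measurable ψ) (hR' : ∀ᵐ y ∂Q, |ψ y| ≤ R) :
    ∫ y, (ψ y - φ y) * (1 - gibbsDensity P Q c φ y) ∂Q =
      ∫ y, ψ y ∂Q - ∫ y, φ y ∂Q - ∫ x, ∫ y, (ψ y - φ y) *
        Real.exp (φ y - softCTransform Q c φ x - c x y) ∂Q ∂P := by
  have hiφ := integrable_of_ae_abs_le hφ hR
  have hiψ := integrable_of_ae_abs_le hψ hR'
  have hid : Integrable (fun y => ψ y - φ y) Q := hiψ.sub hiφ
  have hd := ae_abs_sub_le hR hR'
  rw [integral_integral_mul_gibbs hc hc0 hint hφ hR (h := fun y => ψ y - φ y) (hψ.sub hφ) hd,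
    ← integral_sub hiψ hiφ, ← integral_sub hid]
  · exact integral_congr_ae (ae_of_all _ fun y => by ring)
  · exact ((memLp_top_gibbsDensity hc hc0 hint hφ hR).integrable le_top).bdd_mul (c := 2 * R)
      (hψ.sub hφ).aestronglyMeasurable hd

lemma entropicDual_le (hc : Measurable (Function.uncurry c)) (hc0 : ∀ x y, 0 ≤ c x y)
    (hint : Integrable (fun z : X × Y => Real.exp (c z.1 z.2)) (P.prod Q))
    {φ ψ : Y → ℝ} {R : ℝ} (hφ : Measurable φ) (hR : ∀ᵐ y ∂Q, |φ y| ≤ R)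
    (hψ : Measurable ψ) (hR' : ∀ᵐ y ∂Q, |ψ y| ≤ R) :
    entropicDual P Q c ψ ≤ entropicDual P Q c φ +
      ∫ y, (ψ y - φ y) * (1 - gibbsDensity P Q c φ y) ∂Q := by
  rw [integral_sub_mul_one_sub_gibbsDensity hc hc0 hint hφ hR hψ hR', entropicDual, entropicDual]
  have hF := integrable_softCTransform hc hc0 hint hφ hR
  have hI : Integrable (fun x => ∫ y, (ψ y - φ y) *
      Real.exp (φ y - softCTransform Q c φ x - c x y) ∂Q) P :=
    (integrable_mul_gibbs hc hc0 hint hφ hR (hψ.sub hφ)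
      (ae_abs_sub_le hR hR')).integral_prod_left
  have h : ∫ x, (softCTransform Q c φ x +
      ∫ y, (ψ y - φ y) * Real.exp (φ y - softCTransform Q c φ x - c x y) ∂Q) ∂P ≤
      ∫ x, softCTransform Q c ψ x ∂P :=
    integral_mono (hF.add hI) (integrable_softCTransform hc hc0 hint hψ hR') fun x =>
      add_integral_mul_le_log_integral_exp (hc.of_uncurry_left) (hc0 x) hφ hR hψ hR'
  rw [integral_add hF hI] at h
  linarith

lemma le_entropicDual (hc : Measurable (Function.uncurry c)) (hc0 : ∀ x y, 0 ≤ c x y)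
    (hint : Integrable (fun z : X × Y => Real.exp (c z.1 z.2)) (P.prod Q))
    {φ ψ : Y → ℝ} {R : ℝ} (hφ : Measurable φ) (hR : ∀ᵐ y ∂Q, |φ y| ≤ R)
    (hψ : Measurable ψ) (hR' : ∀ᵐ y ∂Q, |ψ y| ≤ R) :
    entropicDual P Q c φ + ∫ y, (ψ y - φ y) * (1 - gibbsDensity P Q c φ y) ∂Q -
      Real.exp (2 * R) * (∫ z, Real.exp (c z.1 z.2) ∂(P.prod Q)) / 2 *
        ∫ y, (ψ y - φ y) ^ 2 ∂Q ≤ entropicDual P Q c ψ := by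
  rw [integral_sub_mul_one_sub_gibbsDensity hc hc0 hint hφ hR hψ hR', entropicDual, entropicDual]
  have hF := integrable_softCTransform hc hc0 hint hφ hR
  have hI : Integrable (fun x => ∫ y, (ψ y - φ y) *
      Real.exp (φ y - softCTransform Q c φ x - c x y) ∂Q) P :=
    (integrable_mul_gibbs hc hc0 hint hφ hR (hψ.sub hφ)
      (ae_abs_sub_le hR hR')).integral_prod_left
  have hW := integrable_inv_integral_exp_neg hc hc0 hint
  have hWle := integral_inv_integral_exp_neg_le hc hc0 hint
  have hA : 0 ≤ ∫ y, (ψ y - φ y) ^ 2 ∂Q := integral_nonneg fun y => sq_nonneg _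
  set A := ∫ y, (ψ y - φ y) ^ 2 ∂Q with hAdef
  have hFI : Integrable (fun x => softCTransform Q c φ x + ∫ y, (ψ y - φ y) *
      Real.exp (φ y - softCTransform Q c φ x - c x y) ∂Q) P := hF.add hI
  have hV := hW.const_mul (Real.exp (2 * R) / 2 * A)
  have h : ∫ x, softCTransform Q c ψ x ∂P ≤ ∫ x, (softCTransform Q c φ x +
      ∫ y, (ψ y - φ y) * Real.exp (φ y - softCTransform Q c φ x - c x y) ∂Q +
      Real.exp (2 * R) / 2 * A * (∫ y, Real.exp (-c x y) ∂Q)⁻¹) ∂P := by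
    refine integral_mono (integrable_softCTransform hc hc0 hint hψ hR') (hFI.add hV)
      fun x => (log_integral_exp_le_add_integral_mul (hc.of_uncurry_left) (hc0 x)
        hφ hR hψ hR').trans (le_of_eq ?_)
    rw [← hAdef]
    simp only [softCTransform]
    ring
  rw [integral_add hFI hV, integral_add hF hI, integral_const_mul] at h
  have h2 := mul_le_mul_of_nonneg_left hWle
    (show 0 ≤ Real.exp (2 * R) / 2 * A by positivity)
  linarith

end EntropicDual

section ProximalStep

variable {Y : Type*} [MeasurableSpace Y] {Q : Measure Y} [IsProbabilityMeasure Q]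

lemma MeasureTheory.MemLp.integrable_mul_of_top {f g : Y → ℝ} (hf : MemLp f ⊤ Q)
    (hg : MemLp g ⊤ Q) : Integrable (fun y => f y * g y) Q :=
  (MemLp.mul (r := ⊤) hg hf).integrable le_top

lemma integral_mul_nonneg_of_forall_le {a f χ : Y → ℝ} (ha : MemLp a ⊤ Q) (hf : MemLp f ⊤ Q)
    (hχ : MemLp χ ⊤ Q)
    (hmin : ∀ s : ℝ, 0 < s → s ≤ 1 →
      ∫ y, (a y - f y) ^ 2 ∂Q ≤ ∫ y, (a y + s * (χ y - a y) - f y) ^ 2 ∂Q) :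
    0 ≤ ∫ y, (a y - f y) * (χ y - a y) ∂Q := by
  have h1 : Integrable (fun y => (a y - f y) * (a y - f y)) Q :=
    (ha.sub hf).integrable_mul_of_top (ha.sub hf)
  have h2 : Integrable (fun y => (a y - f y) * (χ y - a y)) Q :=
    (ha.sub hf).integrable_mul_of_top (hχ.sub ha)
  have h3 : Integrable (fun y => (χ y - a y) * (χ y - a y)) Q :=
    (hχ.sub ha).integrable_mul_of_top (hχ.sub ha)
  set I := ∫ y, (a y - f y) * (χ y - a y) ∂Q with hI
  set K := ∫ y, (χ y - a y) * (χ y - a y) ∂Q with hK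
  have hK0 : 0 ≤ K := integral_nonneg fun y => mul_self_nonneg _
  have hexpand : ∀ s : ℝ, ∫ y, (a y + s * (χ y - a y) - f y) ^ 2 ∂Q =
      ∫ y, (a y - f y) ^ 2 ∂Q + 2 * s * I + s ^ 2 * K := by
    intro s
    have h12 : Integrable (fun y => (a y - f y) * (a y - f y) +
        2 * s * ((a y - f y) * (χ y - a y))) Q := h1.add (h2.const_mul _)
    simp_rw [sq (a _ - f _)]
    rw [hI, hK, ← integral_const_mul, ← integral_const_mul, ← integral_add h1 (h2.const_mul _),
      ← integral_add h12 (h3.const_mul _)]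
    exact integral_congr_ae (ae_of_all _ fun y => by ring)
  by_contra! hneg
  have hs1 : 0 < min 1 (-I / (K + 1)) :=
    lt_min one_pos (div_pos (by linarith) (by linarith))
  have h := hmin _ hs1 (min_le_left _ _)
  have hs2 : min 1 (-I / (K + 1)) * (K + 1) ≤ -I := by
    rw [← le_div_iff₀ (by linarith)]
    exact min_le_right _ _
  rw [hexpand] at h
  nlinarith

variable {X : Type*} [MeasurableSpace X] {P : Measure X} [IsProbabilityMeasure P]
  {c : X → Y → ℝ}

lemma le_entropicDual_sub_of_proj (hc : Measurable (Function.uncurry c))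
    (hc0 : ∀ x y, 0 ≤ c x y)
    (hint : Integrable (fun z : X × Y => Real.exp (c z.1 z.2)) (P.prod Q))
    {a f χ : Y → ℝ} {R L : ℝ} (ham : Measurable a) (haR : ∀ᵐ y ∂Q, |a y| ≤ R)
    (hfm : Measurable f) (hfR : ∀ᵐ y ∂Q, |f y| ≤ R)
    (hχm : Measurable χ) (hχR : ∀ᵐ y ∂Q, |χ y| ≤ R) (hL0 : 0 < L)
    (hL : L = Real.exp (2 * R) * ∫ z, Real.exp (c z.1 z.2) ∂(P.prod Q))
    (hmin : ∀ s : ℝ, 0 < s → s ≤ 1 →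
      ∫ y, (a y - (f y + L⁻¹ * (1 - gibbsDensity P Q c f y))) ^ 2 ∂Q ≤
        ∫ y, (a y + s * (χ y - a y) - (f y + L⁻¹ * (1 - gibbsDensity P Q c f y))) ^ 2 ∂Q) :
    L * ∫ y, (a y - f y) * (a y - χ y) ∂Q - L / 2 * ∫ y, (a y - f y) * (a y - f y) ∂Q ≤
      entropicDual P Q c a - entropicDual P Q c χ := by
  have ha : MemLp a ⊤ Q := memLp_top_of_bound ham.aestronglyMeasurable R haR
  have hf : MemLp f ⊤ Q := memLp_top_of_bound hfm.aestronglyMeasurable R hfR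
  have hχ : MemLp χ ⊤ Q := memLp_top_of_bound hχm.aestronglyMeasurable R hχR
  have hg : MemLp (fun y => 1 - gibbsDensity P Q c f y) ⊤ Q :=
    (memLp_const 1).sub (memLp_top_gibbsDensity hc hc0 hint hfm hfR)
  have hvar := integral_mul_nonneg_of_forall_le ha (hf.add (hg.const_mul L⁻¹)) hχ hmin
  have hup := entropicDual_le hc hc0 hint hfm hfR hχm hχR
  have hlo := le_entropicDual hc hc0 hint hfm hfR ham haR
  have h1 : Integrable (fun y => (a y - f y) * (a y - χ y)) Q :=
    (ha.sub hf).integrable_mul_of_top (ha.sub hχ)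
  have h2 : Integrable (fun y => (a y - f y) * (1 - gibbsDensity P Q c f y)) Q :=
    (ha.sub hf).integrable_mul_of_top hg
  have h3 : Integrable (fun y => (χ y - f y) * (1 - gibbsDensity P Q c f y)) Q :=
    (hχ.sub hf).integrable_mul_of_top hg
  have hsplit : L * ∫ y, (a y - (f y + L⁻¹ * (1 - gibbsDensity P Q c f y))) * (χ y - a y) ∂Q =
      ∫ y, (a y - f y) * (1 - gibbsDensity P Q c f y) ∂Q -
        ∫ y, (χ y - f y) * (1 - gibbsDensity P Q c f y) ∂Q -
        L * ∫ y, (a y - f y) * (a y - χ y) ∂Q := by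
    have h4 : Integrable (fun y => (a y - f y) * (1 - gibbsDensity P Q c f y) -
      (χ y - f y) * (1 - gibbsDensity P Q c f y)) Q := h2.sub h3
    rw [← integral_const_mul, ← integral_const_mul, ← integral_sub h2 h3,
      ← integral_sub h4 (h1.const_mul _)]
    refine integral_congr_ae (ae_of_all _ fun y => ?_)
    simp only
    field_simp
    ring
  have hvar' := mul_nonneg hL0.le hvar
  simp only [Pi.add_apply] at hvar'
  rw [hsplit] at hvar'
  rw [← hL] at hlo
  simp_rw [sq] at hlo
  linarith

lemma integral_sq_sub_integral_sq_eq {a f b s : Y → ℝ} (ha : MemLp a ⊤ Q) (hf : MemLp f ⊤ Q)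
    (hb : MemLp b ⊤ Q) (hs : MemLp s ⊤ Q) (t : ℝ) :
    ∫ y, (t * a y - (t - 1) * b y - s y) ^ 2 ∂Q -
        ∫ y, (t * f y - (t - 1) * b y - s y) ^ 2 ∂Q =
      2 * t * (t - 1) * ∫ y, (a y - f y) * (a y - b y) ∂Q +
        2 * t * ∫ y, (a y - f y) * (a y - s y) ∂Q -
        t ^ 2 * ∫ y, (a y - f y) * (a y - f y) ∂Q := by
  have h1 : Integrable (fun y => (a y - f y) * (a y - b y)) Q :=
    (ha.sub hf).integrable_mul_of_top (ha.sub hb)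
  have h2 : Integrable (fun y => (a y - f y) * (a y - s y)) Q :=
    (ha.sub hf).integrable_mul_of_top (ha.sub hs)
  have h3 : Integrable (fun y => (a y - f y) * (a y - f y)) Q :=
    (ha.sub hf).integrable_mul_of_top (ha.sub hf)
  have hsq : ∀ g : Y → ℝ, MemLp g ⊤ Q →
      Integrable (fun y => (t * g y - (t - 1) * b y - s y) ^ 2) Q := by
    intro g hg
    simp_rw [sq]
    have h := ((hg.const_mul t).sub (hb.const_mul (t - 1))).sub hs
    exact h.integrable_mul_of_top h
  have h12 : Integrable (fun y => 2 * t * (t - 1) * ((a y - f y) * (a y - b y)) +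
      2 * t * ((a y - f y) * (a y - s y))) Q := (h1.const_mul _).add (h2.const_mul _)
  rw [← integral_sub (hsq a ha) (hsq f hf), ← integral_const_mul, ← integral_const_mul,
    ← integral_const_mul, ← integral_add (h1.const_mul _) (h2.const_mul _),
    ← integral_sub h12 (h3.const_mul _)]
  refine integral_congr_ae (ae_of_all _ fun y => ?_)
  simp only
  ring

end ProximalStep

section Density

lemma integral_withDensity_ofReal_s17 {α : Type*} [MeasurableSpace α] {m : Measure α} {ρ : α → ℝ}
    (hρ : Measurable ρ) (hρ0 : ∀ x, 0 ≤ ρ x) (f : α → ℝ) :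
    ∫ x, f x ∂(m.withDensity fun x => ENNReal.ofReal (ρ x)) = ∫ x, f x * ρ x ∂m := by
  rw [integral_withDensity_eq_integral_toReal_smul hρ.ennreal_ofReal
    (ae_of_all _ fun _ => ENNReal.ofReal_lt_top)]
  refine integral_congr_ae (ae_of_all _ fun x => ?_)
  simp only [ENNReal.toReal_ofReal (hρ0 x), smul_eq_mul]
  ring

lemma isProbabilityMeasure_withDensity_ofReal_s17 {α : Type*} [MeasurableSpace α] {m : Measure α}
    {ρ : α → ℝ} (hρ0 : ∀ x, 0 ≤ ρ x) (h1 : ∫ x, ρ x ∂m = 1) :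
    IsProbabilityMeasure (m.withDensity fun x => ENNReal.ofReal (ρ x)) := by
  have hi : Integrable ρ m := by
    by_contra h
    rw [integral_undef h] at h1
    exact zero_ne_one h1
  constructor
  rw [withDensity_apply _ MeasurableSet.univ, Measure.restrict_univ,
    ← ofReal_integral_eq_lintegral_ofReal hi (ae_of_all _ hρ0), h1, ENNReal.ofReal_one]

lemma prod_withDensity_ofReal_s17 {α β : Type*} [MeasurableSpace α] [MeasurableSpace β]
    {m : Measure α} {m' : Measure β} [SFinite m] [SFinite m'] {ρ : α → ℝ} {σ : β → ℝ}
    (hρ : Measurable ρ) (hρ0 : ∀ x, 0 ≤ ρ x) (hσ : Measurable σ) :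
    (m.withDensity fun x => ENNReal.ofReal (ρ x)).prod
        (m'.withDensity fun x => ENNReal.ofReal (σ x)) =
      (m.prod m').withDensity fun z => ENNReal.ofReal (ρ z.1 * σ z.2) := by
  rw [prod_withDensity hρ.ennreal_ofReal hσ.ennreal_ofReal]
  simp_rw [ENNReal.ofReal_mul (hρ0 _)]

variable {μ ν : (Fin d → ℝ) → ℝ} {c : (Fin d → ℝ) → (Fin d → ℝ) → ℝ} {ε : ℝ}

/-- The measure on `ℝ^d` with Lebesgue density `ρ`. -/
abbrev densityMeasure (ρ : (Fin d → ℝ) → ℝ) : Measure (Fin d → ℝ) :=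
  volume.withDensity fun x => ENNReal.ofReal (ρ x)

lemma phiPlus_eq_softCTransform (hνm : Measurable ν) (hν0 : ∀ y, 0 ≤ ν y)
    (φ : (Fin d → ℝ) → ℝ) :
    phiPlus ν c ε φ = softCTransform (densityMeasure ν) (fun x y => c x y / ε) φ := by
  funext x
  rw [phiPlus, softCTransform, integral_withDensity_ofReal_s17 hνm hν0]

lemma semiDual_eq_entropicDual (hμm : Measurable μ) (hμ0 : ∀ x, 0 ≤ μ x) (hνm : Measurable ν)
    (hν0 : ∀ y, 0 ≤ ν y) (φ : (Fin d → ℝ) → ℝ) :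
    semiDual μ ν c ε φ =
      entropicDual (densityMeasure μ) (densityMeasure ν) (fun x y => c x y / ε) φ := by
  rw [semiDual, entropicDual, integral_withDensity_ofReal_s17 hνm hν0,
    integral_withDensity_ofReal_s17 hμm hμ0, phiPlus_eq_softCTransform hνm hν0]

lemma ae_deltaJ_div_eq (hμm : Measurable μ) (hμ0 : ∀ x, 0 ≤ μ x) (hνm : Measurable ν)
    (hν0 : ∀ y, 0 ≤ ν y) (φ : (Fin d → ℝ) → ℝ) :
    ∀ᵐ y ∂(densityMeasure ν), deltaJ μ ν c ε φ y / ν y =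
      1 - gibbsDensity (densityMeasure μ) (densityMeasure ν) (fun x y => c x y / ε) φ y := by
  rw [ae_withDensity_iff hνm.ennreal_ofReal]
  refine ae_of_all _ fun y hy => ?_
  have hy' : ν y ≠ 0 := fun h => hy (by simp [h])
  have hpi : piY μ ν c ε φ y =
      gibbsDensity (densityMeasure μ) (densityMeasure ν) (fun x y => c x y / ε) φ y * ν y := by
    rw [gibbsDensity, integral_withDensity_ofReal_s17 hμm hμ0, ← integral_mul_const, piY]
    simp only [piJoint, phiPlus_eq_softCTransform hνm hν0]
  rw [deltaJ, hpi]
  field_simp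

lemma integral_exp_mul_mul_eq (hμm : Measurable μ) (hμ0 : ∀ x, 0 ≤ μ x) (hνm : Measurable ν)
    (hν0 : ∀ y, 0 ≤ ν y) :
    ∫ z : (Fin d → ℝ) × (Fin d → ℝ), Real.exp (c z.1 z.2 / ε) * μ z.1 * ν z.2 =
      ∫ z, Real.exp (c z.1 z.2 / ε) ∂((densityMeasure μ).prod (densityMeasure ν)) := by
  rw [prod_withDensity_ofReal_s17 hμm hμ0 hνm, integral_withDensity_ofReal_s17
    (ρ := fun z : (Fin d → ℝ) × (Fin d → ℝ) => μ z.1 * ν z.2) (by fun_prop)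
    (fun z => mul_nonneg (hμ0 _) (hν0 _))]
  simp only [mul_assoc]
  rfl

lemma integrable_exp_prod_withDensity (hμm : Measurable μ) (hμ0 : ∀ x, 0 ≤ μ x)
    (hνm : Measurable ν) (hν0 : ∀ y, 0 ≤ ν y)
    (h : Integrable
      (fun z : (Fin d → ℝ) × (Fin d → ℝ) => Real.exp (c z.1 z.2 / ε) * μ z.1 * ν z.2)) :
    Integrable (fun z : (Fin d → ℝ) × (Fin d → ℝ) => Real.exp (c z.1 z.2 / ε))
      ((densityMeasure μ).prod (densityMeasure ν)) := by
  rw [prod_withDensity_ofReal_s17 hμm hμ0 hνm, integrable_withDensity_iff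
    (f := fun z : (Fin d → ℝ) × (Fin d → ℝ) => ENNReal.ofReal (μ z.1 * ν z.2)) (by fun_prop)
    (ae_of_all _ fun _ => ENNReal.ofReal_lt_top)]
  refine h.congr (ae_of_all _ fun z => ?_)
  simp only [ENNReal.toReal_ofReal (mul_nonneg (hμ0 z.1) (hν0 z.2)), mul_assoc]

end Density

lemma momentum_step {s t : ℝ} (hs : 1 ≤ s) (ht : t = (1 + Real.sqrt (1 + 4 * s ^ 2)) / 2) :
    1 ≤ t ∧ s ≤ t ∧ t ^ 2 - t = s ^ 2 := by
  have h1 : Real.sqrt (1 + 4 * s ^ 2) ^ 2 = 1 + 4 * s ^ 2 := Real.sq_sqrt (by positivity)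
  have h2 : 2 * s ≤ Real.sqrt (1 + 4 * s ^ 2) := Real.le_sqrt_of_sq_le (by nlinarith)
  subst ht
  refine ⟨by linarith, by linarith, by nlinarith⟩

/-- Key Lyapunov identity for the accelerated scheme.
With the accelerated iteration of Statement 14, `v_n = J(φ̃*) − J(φ̄^n)` and
`u_n = t_n φ̄^n − (t_n − 1) φ̄^{n−1} − φ̃*`, for every `n ≥ 1`:
`(2/λ(3B))(t_n² v_n − t_{n+1}² v_{n+1}) ≥ ‖u_{n+1}‖²_{L²(ν)} − ‖u_n‖²_{L²(ν)}`. -/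
theorem accelerated_projSGA_lyapunov
    (μ ν : (Fin d → ℝ) → ℝ) (c : (Fin d → ℝ) → (Fin d → ℝ) → ℝ) (ε : ℝ)
    (hε : 0 < ε) (hμ0 : ∀ x, 0 ≤ μ x) (hν0 : ∀ y, 0 ≤ ν y)
    (hμm : Measurable μ) (hνm : Measurable ν)
    (hμ1 : (∫ x, μ x) = 1) (hν1 : (∫ y, ν y) = 1)
    (hc : Measurable (Function.uncurry c))
    (hc0 : ∀ x y, 0 ≤ c x y)
    (B : ℝ) (hB : 0 < B)
    (hlamfin : Integrable
      (fun z : (Fin d → ℝ) × (Fin d → ℝ) => Real.exp (c z.1 z.2 / ε) * μ z.1 * ν z.2))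
    (SB : Set ((Fin d → ℝ) → ℝ))
    (hSB : SB = {ψ | Measurable ψ ∧ ∀ᵐ y ∂(volume : Measure (Fin d → ℝ)), |ψ y| ≤ B})
    (M : ((Fin d → ℝ) → ℝ) → ℝ → ((Fin d → ℝ) → ℝ))
    (hM : ∀ ψ : (Fin d → ℝ) → ℝ, Measurable ψ →
      (∀ᵐ y ∂(volume : Measure (Fin d → ℝ)), |ψ y| ≤ 3 * B) →
      ∀ η : ℝ, 0 < η → M ψ η ∈ SB ∧ ∀ χ ∈ SB,
        (∫ y, (M ψ η y - (ψ y + η * (deltaJ μ ν c ε ψ y / ν y))) ^ 2 * ν y) ≤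
          ∫ y, (χ y - (ψ y + η * (deltaJ μ ν c ε ψ y / ν y))) ^ 2 * ν y)
    (φ φbar : ℕ → (Fin d → ℝ) → ℝ) (t : ℕ → ℝ)
    (hinit : φ 1 = φbar 0) (hbar0 : φbar 0 ∈ SB) (ht1 : t 1 = 1)
    (hbar : ∀ n : ℕ, 1 ≤ n → φbar n = M (φ n) (lamB μ ν c ε (3 * B))⁻¹)
    (ht : ∀ n : ℕ, 1 ≤ n → t (n + 1) = (1 + Real.sqrt (1 + 4 * t n ^ 2)) / 2)
    (hmom : ∀ n : ℕ, 1 ≤ n → φ (n + 1) = fun y =>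
      φbar n y + ((t n - 1) / t (n + 1)) * (φbar n y - φbar (n - 1) y))
    (φstar : (Fin d → ℝ) → ℝ) (hφstarS : φstar ∈ SB)
    (hmax : ∀ ψ ∈ SB, semiDual μ ν c ε ψ ≤ semiDual μ ν c ε φstar) :
    ∀ n : ℕ, 1 ≤ n →
      (2 / lamB μ ν c ε (3 * B)) *
          (t n ^ 2 * (semiDual μ ν c ε φstar - semiDual μ ν c ε (φbar n)) -
            t (n + 1) ^ 2 *
              (semiDual μ ν c ε φstar - semiDual μ ν c ε (φbar (n + 1)))) ≥
        (∫ y, (t (n + 1) * φbar (n + 1) y - (t (n + 1) - 1) * φbar n y - φstar y) ^ 2 * ν y) -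
          ∫ y, (t n * φbar n y - (t n - 1) * φbar (n - 1) y - φstar y) ^ 2 * ν y := by
  have hPp : IsProbabilityMeasure (densityMeasure μ) :=
    isProbabilityMeasure_withDensity_ofReal_s17 hμ0 hμ1
  have hQp : IsProbabilityMeasure (densityMeasure ν) :=
    isProbabilityMeasure_withDensity_ofReal_s17 hν0 hν1
  have hQac : densityMeasure ν ≪ volume := withDensity_absolutelyContinuous _ _
  have hcε : Measurable (Function.uncurry fun x y => c x y / ε) := hc.div_const ε
  have hcε0 : ∀ x y, 0 ≤ c x y / ε := fun x y => div_nonneg (hc0 x y) hε.le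
  have hint := integrable_exp_prod_withDensity hμm hμ0 hνm hν0 hlamfin
  set L := lamB μ ν c ε (3 * B) with hLdef
  have hL : L = Real.exp (2 * (3 * B)) *
      ∫ z, Real.exp (c z.1 z.2 / ε) ∂((densityMeasure μ).prod (densityMeasure ν)) := by
    rw [hLdef, lamB, integral_exp_mul_mul_eq hμm hμ0 hνm hν0]
  have hL0 : 0 < L := by
    rw [hL]
    exact mul_pos (Real.exp_pos _) (integral_exp_pos hint)
  have hLinv : 0 < L⁻¹ := inv_pos.2 hL0
  have hSBmem : ∀ ψ, ψ ∈ SB ↔ Measurable ψ ∧ ∀ᵐ y, |ψ y| ≤ B := fun ψ => by rw [hSB]; rfl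
  have hSBbound : ∀ ψ ∈ SB, ∀ᵐ y ∂(densityMeasure ν), |ψ y| ≤ 3 * B := fun ψ hψ =>
    hQac.ae_le (((hSBmem ψ).1 hψ).2.mono fun y hy => by linarith)
  have hstep : ∀ ψ, Measurable ψ → (∀ᵐ y, |ψ y| ≤ 3 * B) → ∀ χ ∈ SB,
      L * ∫ y, (M ψ L⁻¹ y - ψ y) * (M ψ L⁻¹ y - χ y) ∂(densityMeasure ν) -
        L / 2 * ∫ y, (M ψ L⁻¹ y - ψ y) * (M ψ L⁻¹ y - ψ y) ∂(densityMeasure ν) ≤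
      semiDual μ ν c ε (M ψ L⁻¹) - semiDual μ ν c ε χ := by
    intro ψ hψm hψB χ hχ
    obtain ⟨haS, hamin⟩ := hM ψ hψm hψB L⁻¹ hLinv
    rw [semiDual_eq_entropicDual hμm hμ0 hνm hν0, semiDual_eq_entropicDual hμm hμ0 hνm hν0]
    have hcongr : ∀ g : (Fin d → ℝ) → ℝ,
        ∫ y, (g y - (ψ y + L⁻¹ * (deltaJ μ ν c ε ψ y / ν y))) ^ 2 * ν y =
          ∫ y, (g y - (ψ y + L⁻¹ * (1 - gibbsDensity (densityMeasure μ) (densityMeasure ν)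
            (fun x y => c x y / ε) ψ y))) ^ 2 ∂(densityMeasure ν) := by
      intro g
      rw [← integral_withDensity_ofReal_s17 hνm hν0]
      refine integral_congr_ae ?_
      filter_upwards [ae_deltaJ_div_eq (c := c) (ε := ε) hμm hμ0 hνm hν0 ψ] with y hy
      rw [hy]
    obtain ⟨ham, haB⟩ := (hSBmem _).1 haS
    obtain ⟨hχm, hχB⟩ := (hSBmem _).1 hχ
    refine le_entropicDual_sub_of_proj hcε hcε0 hint ham (hSBbound _ haS) hψm (hQac.ae_le hψB)
      hχm (hSBbound _ hχ) hL0 hL fun s hs0 hs1 => ?_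
    have hmem : (fun y => M ψ L⁻¹ y + s * (χ y - M ψ L⁻¹ y)) ∈ SB := by
      rw [hSBmem]
      refine ⟨by fun_prop, ?_⟩
      filter_upwards [haB, hχB] with y h1 h2
      rw [abs_le] at *
      constructor <;> nlinarith
    have h := hamin _ hmem
    rwa [hcongr (M ψ L⁻¹), hcongr fun y => M ψ L⁻¹ y + s * (χ y - M ψ L⁻¹ y)] at h
  have ht_ge : ∀ n, 1 ≤ n → 1 ≤ t n := by
    intro n hn
    induction n, hn using Nat.le_induction with
    | base => exact ht1.ge
    | succ n hn ih => exact (momentum_step ih (ht n hn)).1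
  have hextra : ∀ n, 1 ≤ n → φbar n ∈ SB → φbar (n - 1) ∈ SB →
      Measurable (φ (n + 1)) ∧ ∀ᵐ y, |φ (n + 1) y| ≤ 3 * B := by
    intro n hn h1 h2
    obtain ⟨h1m, h1B⟩ := (hSBmem _).1 h1
    obtain ⟨h2m, h2B⟩ := (hSBmem _).1 h2
    obtain ⟨h3, h4, -⟩ := momentum_step (ht_ge n hn) (ht n hn)
    have hβ0 : 0 ≤ (t n - 1) / t (n + 1) := div_nonneg (by linarith [ht_ge n hn]) (by linarith)
    have hβ1 : (t n - 1) / t (n + 1) ≤ 1 := (div_le_one (by linarith)).2 (by linarith)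
    rw [hmom n hn]
    refine ⟨by fun_prop, ?_⟩
    filter_upwards [h1B, h2B] with y h5 h6
    rw [abs_le] at *
    constructor <;> nlinarith
  have hiter : ∀ n, φbar n ∈ SB ∧ φbar (n + 1) ∈ SB ∧
      Measurable (φ (n + 1)) ∧ ∀ᵐ y, |φ (n + 1) y| ≤ 3 * B := by
    have hnext : ∀ n, Measurable (φ (n + 1)) → (∀ᵐ y, |φ (n + 1) y| ≤ 3 * B) →
        φbar (n + 1) ∈ SB := fun n h1 h2 => by
      rw [hbar (n + 1) (by omega)]
      exact (hM _ h1 h2 _ hLinv).1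
    intro n
    induction n with
    | zero =>
      obtain ⟨h1, h2⟩ := (hSBmem _).1 hbar0
      have h3 : ∀ᵐ y, |φ 1 y| ≤ 3 * B := by
        rw [hinit]
        exact h2.mono fun y hy => by linarith
      have h4 : Measurable (φ 1) := hinit ▸ h1
      exact ⟨hbar0, hnext 0 h4 h3, h4, h3⟩
    | succ n ih =>
      obtain ⟨h1, h2⟩ := hextra (n + 1) (by omega) ih.2.1 ih.1
      exact ⟨ih.2.1, hnext _ h1 h2, h1, h2⟩
  intro n hn
  obtain ⟨hb, ha, hfm, hfB⟩ := hiter n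
  have hb' : φbar (n - 1) ∈ SB := (hiter (n - 1)).1
  obtain ⟨h1, -, h3⟩ := momentum_step (ht_ge n hn) (ht n hn)
  have hstepb := hstep _ hfm hfB _ hb
  have hsteps := hstep _ hfm hfB _ hφstarS
  rw [← hbar (n + 1) (by omega)] at hstepb hsteps
  have hmemLp : ∀ ψ ∈ SB, MemLp ψ ⊤ (densityMeasure ν) := fun ψ hψ =>
    memLp_top_of_bound ((hSBmem ψ).1 hψ).1.aestronglyMeasurable (3 * B) (hSBbound ψ hψ)
  have hu : ∀ y, t n * φbar n y - (t n - 1) * φbar (n - 1) y - φstar y =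
      t (n + 1) * φ (n + 1) y - (t (n + 1) - 1) * φbar n y - φstar y := by
    intro y
    have : t (n + 1) ≠ 0 := by linarith
    rw [hmom n hn]
    field_simp
    ring
  simp_rw [hu]
  rw [← integral_withDensity_ofReal_s17 hνm hν0, ← integral_withDensity_ofReal_s17 hνm hν0,
    integral_sq_sub_integral_sq_eq (hmemLp _ ha)
      (memLp_top_of_bound hfm.aestronglyMeasurable (3 * B) (hQac.ae_le hfB))
      (hmemLp _ hb) (hmemLp _ hφstarS) (t (n + 1))]
  set s := t (n + 1)
  have hb2 := mul_le_mul_of_nonneg_left hstepb (show 0 ≤ 2 / L * (s * (s - 1)) from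
    mul_nonneg (by positivity) (mul_nonneg (by linarith) (by linarith)))
  have hs2 := mul_le_mul_of_nonneg_left hsteps (show 0 ≤ 2 / L * s from
    mul_nonneg (by positivity) (by linarith))
  rw [← h3]
  refine ge_iff_le.2 (le_trans (le_of_eq ?_) ((add_le_add hb2 hs2).trans (le_of_eq ?_)))
  · field_simp
    ring
  · ring
end
end
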